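/- arXiv:1509.03919 — 14 statements merged into one kernel-verified Lean document; each statement's English description precedes it below -/
import Mathlib

section
/- Let a < b and let φ : ℝ → ℝ. Assume there exists a countable family of pairwise disjoint intervals [aₙ, bₙ) whose union is [a, b) such that on each open interval (aₙ, bₙ): φ is monotone (either monotonically increasing or monotonically decreasing), φ is twice continuously differentiable with φ, φ′ and φ″ bounded on (aₙ, bₙ), and the set {x ∈ (aₙ, bₙ) : φ′(x) = 0} is countable. Then the integrals ∫ₐᵇ cos(t·φ(x)) dx and ∫ₐᵇ sin(t·φ(x)) dx both tend to 0 as t → ∞. -/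
open MeasureTheory Filter

/-- A function `φ` is countably piecewise monotone on `[a, b)` with `C²_B` pieces:
`[a, b)` decomposes into countably many pairwise disjoint intervals `[aN n, bN n)`,
and on the interior of each piece `φ` is monotone, twice continuously differentiable
with `φ`, `φ'`, `φ''` bounded, and has a countable critical set. -/
def PiecewiseMonotoneC2B (φ : ℝ → ℝ) (a b : ℝ) : Prop :=
  ∃ aN bN : ℕ → ℝ,
    (⋃ n, Set.Ico (aN n) (bN n)) = Set.Ico a b ∧
    (Pairwise fun n m => Disjoint (Set.Ico (aN n) (bN n)) (Set.Ico (aN m) (bN m))) ∧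
    ∀ n, (MonotoneOn φ (Set.Ioo (aN n) (bN n)) ∨ AntitoneOn φ (Set.Ioo (aN n) (bN n))) ∧
      ContDiffOn ℝ 2 φ (Set.Ioo (aN n) (bN n)) ∧
      (∃ M : ℝ, ∀ x ∈ Set.Ioo (aN n) (bN n),
        |φ x| ≤ M ∧ |deriv φ x| ≤ M ∧ |deriv (deriv φ) x| ≤ M) ∧
      ({x ∈ Set.Ioo (aN n) (bN n) | deriv φ x = 0}).Countable

/-- On one piece, the preimage of a null set is null. -/
theorem piece_null (φ : ℝ → ℝ) (p q : ℝ)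
    (hm : MonotoneOn φ (Set.Ioo p q) ∨ AntitoneOn φ (Set.Ioo p q))
    (hc : ContDiffOn ℝ 2 φ (Set.Ioo p q))
    (hz : ({x ∈ Set.Ioo p q | deriv φ x = 0}).Countable)
    (N : Set ℝ) (hN : MeasurableSet N) (hN0 : volume N = 0) :
    ∀ᵐ x ∂(volume.restrict (Set.Ioo p q)), φ x ∉ N := by
  have hinj : Set.InjOn φ (Set.Ioo p q) := by
    have key : ∀ x ∈ Set.Ioo p q, ∀ y ∈ Set.Ioo p q, x < y → φ x ≠ φ y := by
      intro x hx y hy hxy he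
      have hsub : Set.Ioo x y ⊆ {x ∈ Set.Ioo p q | deriv φ x = 0} := by
        intro z hz
        refine ⟨⟨hx.1.trans hz.1, hz.2.trans hy.2⟩, ?_⟩
        have : φ =ᶠ[nhds z] fun _ => φ x := by
          filter_upwards [Ioo_mem_nhds hz.1 hz.2] with w hw
          have hw' : w ∈ Set.Ioo p q := ⟨hx.1.trans hw.1, hw.2.trans hy.2⟩
          rcases hm with hm | hm
          · have h1 := hm hx hw' hw.1.le
            have h2 := hm hw' hy hw.2.le
            linarith
          · have h1 := hm hx hw' hw.1.le
            have h2 := hm hw' hy hw.2.le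
            linarith
        rw [this.deriv_eq]
        simp
      have h0 := (hz.mono hsub).measure_zero volume
      rw [Real.volume_Ioo, ENNReal.ofReal_eq_zero] at h0
      linarith
    intro x hx y hy he
    rcases lt_trichotomy x y with h | h | h
    · exact absurd he (key x hx y hy h)
    · exact h
    · exact absurd he.symm (key y hy x hx h)
  have hms : MeasurableSet (Set.Ioo p q ∩ φ ⁻¹' N) := by
    have h1 : Measurable ((Set.Ioo p q).domRestrict φ) :=
      hc.continuousOn.domRestrict.measurable
    have h2 := measurableSet_Ioo.subtype_image (h1 hN)
    convert h2 using 1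
    ext x
    simp [Set.domRestrict]
    tauto
  have hd : ∀ x ∈ Set.Ioo p q ∩ φ ⁻¹' N,
      HasDerivWithinAt φ (deriv φ x) (Set.Ioo p q ∩ φ ⁻¹' N) x := by
    intro x hx
    have : DifferentiableAt ℝ φ x :=
      (hc.differentiableOn (by norm_num)).differentiableAt (Ioo_mem_nhds hx.1.1 hx.1.2)
    exact this.hasDerivAt.hasDerivWithinAt
  have harea := lintegral_image_eq_lintegral_abs_deriv_mul hms hd
    (hinj.mono Set.inter_subset_left) (fun _ => 1)
  have himg : volume (φ '' (Set.Ioo p q ∩ φ ⁻¹' N)) = 0 :=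
    measure_mono_null (by rintro _ ⟨x, hx, rfl⟩; exact hx.2) hN0
  simp only [lintegral_const, Measure.restrict_apply_univ, himg, mul_one, mul_zero] at harea
  have hae := (lintegral_eq_zero_iff
    (ENNReal.measurable_ofReal.comp (measurable_deriv φ).abs)).1 harea.symm
  rw [Filter.EventuallyEq, ae_restrict_iff' hms] at hae
  rw [ae_restrict_iff' measurableSet_Ioo]
  filter_upwards [hae, hz.ae_notMem volume] with x hx hxz hxI hxN
  have h3 := hx ⟨hxI, hxN⟩
  simp only [Function.comp, Pi.zero_apply, ENNReal.ofReal_eq_zero] at h3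
  exact hxz ⟨hxI, abs_eq_zero.1 (le_antisymm h3 (abs_nonneg _))⟩

theorem rl_aux (μ : Measure ℝ) [IsFiniteMeasure μ] (φ : ℝ → ℝ) (hφ : AEMeasurable φ μ)
    (hac : μ.map φ ≪ volume) :
    Tendsto (fun t : ℝ => ∫ x, Complex.exp ((t * φ x : ℝ) * Complex.I) ∂μ) atTop (nhds 0) := by
  have h := Real.tendsto_integral_exp_smul_cocompact
    (fun y : ℝ => (((μ.map φ).rnDeriv volume y).toReal : ℂ))
  have ht : Tendsto (fun t : ℝ => (-(2 * Real.pi)⁻¹) * t) atTop (cocompact ℝ) := by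
    refine Tendsto.mono_right ?_ atBot_le_cocompact
    exact tendsto_id.const_mul_atTop_of_neg (by have := Real.pi_pos; simp; positivity)
  refine (h.comp ht).congr fun t => ?_
  have h1 : ∫ x, Complex.exp ((t * φ x : ℝ) * Complex.I) ∂μ
      = ∫ y, Complex.exp ((t * y : ℝ) * Complex.I) ∂(μ.map φ) := by
    rw [integral_map hφ]
    exact Continuous.aestronglyMeasurable (by fun_prop)
  rw [h1, ← integral_rnDeriv_smul hac]
  simp only [Function.comp]
  congr 1
  ext y
  rw [Circle.smul_def, Real.fourierChar_apply, smul_eq_mul, Complex.real_smul, mul_comm]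
  congr 3
  have := Real.pi_pos.ne'
  norm_cast
  field_simp

theorem oscillatory_integral_cos_sin_tendsto_zero
    (a b : ℝ) (hab : a < b) (φ : ℝ → ℝ)
    (hφ : PiecewiseMonotoneC2B φ a b) :
    Tendsto (fun t : ℝ => ∫ x in a..b, Real.cos (t * φ x)) atTop (nhds 0) ∧
    Tendsto (fun t : ℝ => ∫ x in a..b, Real.sin (t * φ x)) atTop (nhds 0) := by
  obtain ⟨aN, bN, hU, -, hP⟩ := hφ
  have hres : ∀ p q : ℝ, (volume : Measure ℝ).restrict (Set.Ico p q)
      = volume.restrict (Set.Ioo p q) := fun p q =>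
    Measure.restrict_congr_set Ioo_ae_eq_Ico.symm
  have hmeas : AEMeasurable φ (volume.restrict (Set.Ico a b)) := by
    rw [← hU, aemeasurable_iUnion_iff]
    intro n
    rw [hres]
    exact (hP n).2.1.continuousOn.aemeasurable measurableSet_Ioo
  have hac : (volume.restrict (Set.Ico a b)).map φ ≪ volume := by
    refine Measure.AbsolutelyContinuous.mk fun N hN hN0 => ?_
    rw [Measure.map_apply_of_aemeasurable hmeas hN]
    have : ∀ᵐ x ∂(volume.restrict (Set.Ico a b)), φ x ∉ N := by
      rw [← hU, ae_restrict_iUnion_iff]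
      intro n
      rw [hres]
      exact piece_null φ _ _ (hP n).1 (hP n).2.1 (hP n).2.2.2 N hN hN0
    rw [ae_iff] at this
    simp only [not_not] at this
    exact this
  have key := rl_aux _ φ hmeas hac
  have hint : ∀ t : ℝ, Integrable (fun x => Complex.exp ((t * φ x : ℝ) * Complex.I))
      (volume.restrict (Set.Ico a b)) := by
    intro t
    refine Integrable.of_bound (C := 1) ?_ ?_
    · have hc : Continuous fun y : ℝ => Complex.exp ((t * y : ℝ) * Complex.I) := by fun_prop
      exact (hc.measurable.comp_aemeasurable hmeas).aestronglyMeasurable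
    · exact Eventually.of_forall fun x => (Complex.norm_exp_ofReal_mul_I _).le
  have hI : ∀ f : ℝ → ℝ, ∫ x in a..b, f x = ∫ x in Set.Ico a b, f x := fun f => by
    rw [intervalIntegral.integral_of_le hab.le, ← integral_Ico_eq_integral_Ioc]
  constructor
  · have h := (Complex.continuous_re.tendsto 0).comp key
    rw [Complex.zero_re] at h
    refine h.congr fun t => ?_
    rw [hI]
    have := integral_re (hint t)
    simp only [RCLike.re_eq_complex_re, Complex.exp_ofReal_mul_I_re] at this
    exact this.symm
  · have h := (Complex.continuous_im.tendsto 0).comp key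
    rw [Complex.zero_im] at h
    refine h.congr fun t => ?_
    rw [hI]
    have := integral_im (hint t)
    simp only [RCLike.im_eq_complex_im, Complex.exp_ofReal_mul_I_im] at this
    exact this.symm
end

section
/- Let a < b and let φ : ℝ → ℝ satisfy: there exists a countable family of pairwise disjoint intervals [aₙ, bₙ) whose union is [a, b) such that on each open interval (aₙ, bₙ), φ is monotone, twice continuously differentiable with φ, φ′, φ″ bounded, and the set {x ∈ (aₙ, bₙ) : φ′(x) = 0} is countable. Let f : ℝ → ℂ be Lebesgue integrable on [a, b]. Then ∫ₐᵇ f(x) e^{i t φ(x)} dx → 0 as t → ∞. -/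
open MeasureTheory Filter

/-- Riemann–Lebesgue in exponential form. -/
lemma rl_exp (g : ℝ → ℂ) :
    Tendsto (fun t : ℝ => ∫ u, g u * Complex.exp (Complex.I * t * u)) atTop (nhds 0) := by
  have h := Real.tendsto_integral_exp_smul_cocompact g
  have h2 : Tendsto (fun t : ℝ => -(t / (2 * Real.pi))) atTop (cocompact ℝ) :=
    (tendsto_neg_atTop_atBot.comp
      (tendsto_id.atTop_div_const (by positivity))).mono_right atBot_le_cocompact
  refine (h.comp h2).congr fun t => ?_
  refine integral_congr_ae (Eventually.of_forall fun u => ?_)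
  simp only [Circle.smul_def, Real.fourierChar_apply, smul_eq_mul]
  rw [mul_comm]
  congr 2
  have : (Real.pi : ℂ) ≠ 0 := by exact_mod_cast Real.pi_ne_zero
  push_cast
  field_simp

lemma piece_injOn (φ : ℝ → ℝ) (c d : ℝ)
    (hm : MonotoneOn φ (Set.Ioo c d) ∨ AntitoneOn φ (Set.Ioo c d))
    (hc : ({x ∈ Set.Ioo c d | deriv φ x = 0}).Countable) :
    Set.InjOn φ (Set.Ioo c d) := by
  have key : ∀ x ∈ Set.Ioo c d, ∀ y ∈ Set.Ioo c d, x < y → φ x ≠ φ y := by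
    intro x hx y hy hxy he
    have hsub : Set.Ioo x y ⊆ {x ∈ Set.Ioo c d | deriv φ x = 0} := by
      intro z hz
      refine ⟨⟨hx.1.trans hz.1, hz.2.trans hy.2⟩, ?_⟩
      have : φ =ᶠ[nhds z] fun _ => φ x := by
        filter_upwards [Ioo_mem_nhds hz.1 hz.2] with w hw
        have hw' : w ∈ Set.Ioo c d := ⟨hx.1.trans hw.1, hw.2.trans hy.2⟩
        rcases hm with hm | hm
        · have h1 := hm hx hw' hw.1.le
          have h2 := hm hw' hy hw.2.le
          linarith
        · have h1 := hm hx hw' hw.1.le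
          have h2 := hm hw' hy hw.2.le
          linarith
      rw [this.deriv_eq]
      simp
    exact (Cardinal.Real.Ioo_countable_iff.1
      (hc.mono hsub)).not_gt hxy
  intro x hx y hy he
  rcases lt_trichotomy x y with h | h | h
  · exact absurd he (key x hx y hy h)
  · exact h
  · exact absurd he.symm (key y hy x hx h)

lemma piece_tendsto (φ : ℝ → ℝ) (c d : ℝ)
    (hm : MonotoneOn φ (Set.Ioo c d) ∨ AntitoneOn φ (Set.Ioo c d))
    (hd : ContDiffOn ℝ 2 φ (Set.Ioo c d))
    (hc : ({x ∈ Set.Ioo c d | deriv φ x = 0}).Countable) (f : ℝ → ℂ) :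
    Tendsto (fun t : ℝ => ∫ x in Set.Ico c d, f x * Complex.exp (Complex.I * t * φ x))
      atTop (nhds 0) := by
  have hinj := piece_injOn φ c d hm hc
  set Z := {x ∈ Set.Ioo c d | deriv φ x = 0} with hZ
  set S := Set.Ioo c d \ Z with hS
  have hSm : MeasurableSet S := measurableSet_Ioo.diff hc.measurableSet
  have hSs : S ⊆ Set.Ioo c d := Set.sdiff_subset
  have hSae : S =ᵐ[volume] Set.Ico c d :=
    (sdiff_null_ae_eq_self (hc.measure_zero _)).trans Ioo_ae_eq_Ico
  have hder : ∀ x ∈ S, HasDerivWithinAt φ (deriv φ x) S x := fun x hx =>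
    ((hd.differentiableOn (by norm_num)).differentiableAt
      (isOpen_Ioo.mem_nhds (hSs hx))).hasDerivAt.hasDerivWithinAt
  have hSinj : Set.InjOn φ S := hinj.mono hSs
  have hIm : MeasurableSet (φ '' S) :=
    hSm.image_of_continuousOn_injOn (fun x hx => (hder x hx).continuousWithinAt) hSinj
  let ψ := Function.invFunOn φ S
  let g : ℝ → ℂ := (φ '' S).indicator fun u => ((|deriv φ (ψ u)|⁻¹ : ℝ) : ℂ) * f (ψ u)
  refine (rl_exp g).congr fun t => ?_
  have e1 : ∫ u, g u * Complex.exp (Complex.I * t * u) =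
      ∫ u in φ '' S, (((|deriv φ (ψ u)|⁻¹ : ℝ) : ℂ) * f (ψ u)) *
        Complex.exp (Complex.I * t * u) := by
    rw [← integral_indicator hIm]
    refine integral_congr_ae (Eventually.of_forall fun u => ?_)
    by_cases hu : u ∈ φ '' S <;> simp [g, hu]
  rw [e1, integral_image_eq_integral_abs_deriv_smul hSm hder hSinj,
    ← setIntegral_congr_set hSae]
  refine setIntegral_congr_fun hSm fun x hx => ?_
  have hψ : ψ (φ x) = x := hSinj.leftInvOn_invFunOn hx
  have hne : deriv φ x ≠ 0 := fun h => hx.2 ⟨hx.1, h⟩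
  have hne' : ((|deriv φ x| : ℝ) : ℂ) ≠ 0 := by exact_mod_cast abs_ne_zero.2 hne
  simp only [hψ, Complex.real_smul, Complex.ofReal_inv]
  field_simp

theorem oscillatory_integral_tendsto_zero
    (a b : ℝ) (hab : a < b) (φ : ℝ → ℝ)
    (hφ : PiecewiseMonotoneC2B φ a b)
    (f : ℝ → ℂ) (hf : IntegrableOn f (Set.Icc a b)) :
    Tendsto (fun t : ℝ => ∫ x in a..b, f x * Complex.exp (Complex.I * t * φ x))
      atTop (nhds 0) := by
  obtain ⟨aN, bN, hU, hdisj, hp⟩ := hφ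
  have hfI : IntegrableOn f (⋃ n, Set.Ico (aN n) (bN n)) := by
    rw [hU]; exact hf.mono_set Set.Ico_subset_Icc_self
  have hnorm : ∀ t x : ℝ, ‖Complex.exp (Complex.I * t * φ x)‖ = 1 := by
    intro t x
    rw [show Complex.I * t * φ x = ((t * φ x : ℝ) : ℂ) * Complex.I by push_cast; ring]
    exact Complex.norm_exp_ofReal_mul_I _
  have hFI : ∀ t : ℝ, IntegrableOn (fun x => f x * Complex.exp (Complex.I * t * φ x))
      (⋃ n, Set.Ico (aN n) (bN n)) := by
    intro t
    refine Integrable.mono hfI ?_ (Eventually.of_forall fun x => by simp [hnorm])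
    refine hfI.aestronglyMeasurable.mul ?_
    refine AEStronglyMeasurable.iUnion fun n => ?_
    rw [← Measure.restrict_congr_set (Ioo_ae_eq_Ico (μ := volume))]
    refine ContinuousOn.aestronglyMeasurable ?_ measurableSet_Ioo
    have := (hp n).2.1.continuousOn
    fun_prop
  have hsplit : ∀ t : ℝ, ∑' n, ∫ x in Set.Ico (aN n) (bN n),
      f x * Complex.exp (Complex.I * t * φ x) =
      ∫ x in a..b, f x * Complex.exp (Complex.I * t * φ x) := by
    intro t
    rw [intervalIntegral.integral_of_le hab.le, ← integral_Ico_eq_integral_Ioc, ← hU,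
      integral_iUnion (fun _ => measurableSet_Ico) hdisj (hFI t)]
  refine Tendsto.congr hsplit ?_
  have hsum := (hasSum_integral_iUnion (fun _ => measurableSet_Ico) hdisj hfI.norm).summable
  have := tendsto_tsum_of_dominated_convergence (𝓕 := atTop)
    (f := fun (t : ℝ) n => ∫ x in Set.Ico (aN n) (bN n),
      f x * Complex.exp (Complex.I * t * φ x)) (g := fun _ => 0) hsum
    (fun n => piece_tendsto φ _ _ (hp n).1 (hp n).2.1 (hp n).2.2.2 f)
    (Eventually.of_forall fun t n => (norm_integral_le_integral_norm _).trans
      (by simp [hnorm]))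
  simpa using this
end

section
/- For every unitary 3 × 3 complex matrix J (i.e., Jᴴ J = 1 where Jᴴ is the conjugate transpose), the matrix J · J* − 1 has determinant zero, where J* denotes the entrywise complex conjugate of J; equivalently, 1 is an eigenvalue of J · J*. -/
open Matrix

theorem one_is_eigenvalue_of_J_mul_conj_J (J : Matrix (Fin 3) (Fin 3) ℂ)
    (hJ : Jᴴ * J = 1) :
    (J * J.map (starRingEnd ℂ) - 1).det = 0 ∧
    ∃ v : Fin 3 → ℂ, v ≠ 0 ∧ (J * J.map (starRingEnd ℂ)).mulVec v = v := by
  have h1 : Jᵀ * J.map (starRingEnd ℂ) = 1 := by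
    have h := congrArg Matrix.transpose hJ
    rw [Matrix.transpose_mul, Matrix.transpose_one] at h
    exact h
  have h2 : J * J.map (starRingEnd ℂ) - 1 = (J - Jᵀ) * J.map (starRingEnd ℂ) := by
    rw [Matrix.sub_mul, h1]
  have h3 : (J - Jᵀ).det = 0 := by
    rw [Matrix.det_fin_three]
    simp only [Matrix.sub_apply, Matrix.transpose_apply]
    ring
  have h4 : (J * J.map (starRingEnd ℂ) - 1).det = 0 := by
    rw [h2, Matrix.det_mul, h3, zero_mul]
  refine ⟨h4, ?_⟩
  obtain ⟨v, hv, hv'⟩ := Matrix.exists_mulVec_eq_zero_iff.mpr h4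
  refine ⟨v, hv, ?_⟩
  rw [Matrix.sub_mulVec, Matrix.one_mulVec] at hv'
  exact sub_eq_zero.mp hv'
end

section
/- Let P be a real orthogonal 3 × 3 matrix (Pᵀ P = 1), let ω₁, ω₂, ω₃ be real numbers, and define the unitary coin operator C = P_ℂ · diag(e^{iω₁}, e^{iω₂}, e^{iω₃}) · P_ℂᵀ, where P_ℂ is P regarded as a complex matrix. For real k, l let M(k, l) = diag(1, e^{−ik}, e^{−il}). Then for all real k and l, the matrix M(k, l) · Cᴴ · M(k, l)ᴴ · C − 1 has determinant zero; that is, 1 is an eigenvalue of the Fourier-space evolution operator Ũ = M Cᴴ Mᴴ C. -/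
open Matrix Complex

/-- The Fourier-space shift matrix `M(k, l) = diag(1, e^{-ik}, e^{-il})`. -/
noncomputable def Mkl (k l : ℝ) : Matrix (Fin 3) (Fin 3) ℂ :=
  Matrix.diagonal ![1, Complex.exp (-Complex.I * k), Complex.exp (-Complex.I * l)]

theorem Mkl_star_mul (k l : ℝ) : (Mkl k l)ᴴ * Mkl k l = 1 := by
  have h : ∀ x : ℝ, (starRingEnd ℂ) (Complex.exp (-Complex.I * x)) *
      Complex.exp (-Complex.I * x) = 1 := by
    intro x
    rw [← Complex.exp_conj, ← Complex.exp_add]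
    simp
  unfold Mkl
  rw [Matrix.diagonal_conjTranspose, Matrix.diagonal_mul_diagonal, ← Matrix.diagonal_one]
  congr 1
  funext i
  fin_cases i
  · simp
  · simpa using h k
  · simpa using h l

theorem one_is_eigenvalue_of_evolution_operator
    (P : Matrix (Fin 3) (Fin 3) ℝ) (hP : Pᵀ * P = 1) (ω : Fin 3 → ℝ)
    (C : Matrix (Fin 3) (Fin 3) ℂ)
    (hC : C = (P.map Complex.ofReal) *
        Matrix.diagonal (fun i => Complex.exp (Complex.I * ω i)) *
        (P.map Complex.ofReal)ᵀ) :
    ∀ k l : ℝ, (Mkl k l * Cᴴ * (Mkl k l)ᴴ * C - 1).det = 0 := by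
  intro k l
  have hM := Mkl_star_mul k l
  have hNt : ((Mkl k l)ᴴ)ᵀ = (Mkl k l)ᴴ := by
    unfold Mkl
    rw [Matrix.diagonal_conjTranspose, Matrix.diagonal_transpose]
  have hCt : Cᵀ = C := by
    rw [hC]
    simp [Matrix.transpose_mul, Matrix.mul_assoc]
  have hQ : (P.map Complex.ofReal)ᵀ * P.map Complex.ofReal = 1 := by
    have := congrArg (fun A : Matrix (Fin 3) (Fin 3) ℝ => A.map Complex.ofRealHom) hP
    simp only [Matrix.map_mul] at this
    rw [Matrix.map_one _ (map_zero _) (map_one _)] at this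
    exact this
  have hQ' := mul_eq_one_comm.mp hQ
  have hQs : (P.map Complex.ofReal)ᴴ = (P.map Complex.ofReal)ᵀ := by
    ext i j
    simp
  have hQs' : ((P.map Complex.ofReal)ᵀ)ᴴ = P.map Complex.ofReal := by
    ext i j
    simp
  have hD : Matrix.diagonal (fun i => Complex.exp (Complex.I * ω i)) *
      (Matrix.diagonal (fun i => Complex.exp (Complex.I * ω i)))ᴴ = 1 := by
    rw [Matrix.diagonal_conjTranspose, Matrix.diagonal_mul_diagonal, ← Matrix.diagonal_one]
    congr 1
    funext i
    simp only [Pi.star_apply, RCLike.star_def]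
    rw [← Complex.exp_conj, ← Complex.exp_add]
    simp
  have hCC : C * Cᴴ = 1 := by
    rw [hC, Matrix.conjTranspose_mul, Matrix.conjTranspose_mul, hQs, hQs']
    generalize P.map Complex.ofReal = Q at *
    generalize Matrix.diagonal (fun i => Complex.exp (Complex.I * ω i)) = D at *
    calc Q * D * Qᵀ * (Q * (Dᴴ * Qᵀ)) = Q * D * (Qᵀ * Q) * Dᴴ * Qᵀ := by
          simp only [Matrix.mul_assoc]
      _ = Q * (D * Dᴴ) * Qᵀ := by rw [hQ]; simp only [Matrix.mul_assoc, Matrix.one_mul]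
      _ = 1 := by rw [hD, Matrix.mul_one, hQ']
  clear hC hQ hQ' hQs hQs' hD
  generalize (Mkl k l)ᴴ = N at *
  generalize Mkl k l = M at *
  have key : C * N * (M * Cᴴ * N * C - 1) = N * C - C * N := by
    calc C * N * (M * Cᴴ * N * C - 1) = C * (N * M) * Cᴴ * N * C - C * N := by
          simp only [Matrix.mul_assoc, Matrix.mul_sub, Matrix.mul_one]
      _ = N * C - C * N := by rw [hM, Matrix.mul_one, hCC, Matrix.one_mul]
  have hz : (N * C - C * N).det = 0 := by
    have h1 : (N * C - C * N)ᵀ = -(N * C - C * N) := by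
      rw [Matrix.transpose_sub, Matrix.transpose_mul, Matrix.transpose_mul, hNt, hCt, neg_sub]
    have h2 := congrArg Matrix.det h1
    rw [Matrix.det_transpose, Matrix.det_neg] at h2
    simp only [Fintype.card_fin] at h2
    linear_combination h2 / 2
  have hu : C.det * N.det ≠ 0 := by
    have h1 := congrArg Matrix.det hCC
    have h2 := congrArg Matrix.det hM
    rw [Matrix.det_mul, Matrix.det_one] at h1 h2
    exact mul_ne_zero (left_ne_zero_of_mul_eq_one h1) (left_ne_zero_of_mul_eq_one h2)
  rw [← key, Matrix.det_mul, Matrix.det_mul] at hz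
  exact (mul_eq_zero.mp hz).resolve_left hu
end

section
/- Let G = (1/3)·[[−1, 2, 2], [2, −1, 2], [2, 2, −1]] be the 3D Grover coin (regarded as a complex matrix) and for real k, l let M(k, l) = diag(1, e^{−ik}, e^{−il}) and Ũ(k, l) = M(k, l) · G · M(k, l)ᴴ · G. Let φ₁(k, l) ∈ ℂ³ be the vector (2cos(k − l) − 2, 1 − e^{i(l−k)} + e^{−ik} − e^{−il}, 1 − e^{i(k−l)} + e^{−il} − e^{−ik}). Then for all real k and l, Ũ(k, l) · φ₁(k, l) = φ₁(k, l); moreover φ₁(k, l) ≠ 0 whenever k − l is not an integer multiple of 2π, so 1 is an eigenvalue of Ũ(k, l) with eigenvector φ₁(k, l) for such k, l. -/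
open Matrix Real

/-- The 3D Grover coin. -/
noncomputable def GroverCoin3 : Matrix (Fin 3) (Fin 3) ℂ :=
  (1/3 : ℂ) • !![-1, 2, 2; 2, -1, 2; 2, 2, -1]

/-- The Fourier-space evolution operator of the Grover walk on the honeycomb network. -/
noncomputable def Utilde (k l : ℝ) : Matrix (Fin 3) (Fin 3) ℂ :=
  Mkl k l * GroverCoin3 * (Mkl k l)ᴴ * GroverCoin3

/-- The eigenvector of `Utilde k l` with eigenvalue `1`. -/
noncomputable def phi1 (k l : ℝ) : Fin 3 → ℂ :=
  ![((2 * Real.cos (k - l) - 2 : ℝ) : ℂ),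
    1 - Complex.exp (Complex.I * (l - k)) + Complex.exp (-Complex.I * k)
      - Complex.exp (-Complex.I * l),
    1 - Complex.exp (Complex.I * (k - l)) + Complex.exp (-Complex.I * l)
      - Complex.exp (-Complex.I * k)]

/-- The Grover coin acts as `-1` on vectors with coordinate sum zero. -/
theorem groverCoin3_mulVec_of_sum_zero (x y z : ℂ) (h : x + y + z = 0) :
    GroverCoin3.mulVec ![x, y, z] = ![-x, -y, -z] := by
  have hz : z = -x - y := by linear_combination h
  subst hz
  ext i
  fin_cases i <;>
    simp [GroverCoin3, Matrix.mulVec, dotProduct, Fin.sum_univ_three] <;> ring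

theorem Mkl_mulVec (k l : ℝ) (x y z : ℂ) :
    (Mkl k l).mulVec ![x, y, z] =
      ![x, Complex.exp (-Complex.I * k) * y, Complex.exp (-Complex.I * l) * z] := by
  ext i
  fin_cases i <;> simp [Mkl, Matrix.mulVec_diagonal]

theorem Mkl_conj_mulVec (k l : ℝ) (x y z : ℂ) :
    ((Mkl k l)ᴴ).mulVec ![x, y, z] =
      ![x, (Complex.exp (-Complex.I * k))⁻¹ * y, (Complex.exp (-Complex.I * l))⁻¹ * z] := by
  ext i
  fin_cases i <;>
    simp [Mkl, Matrix.diagonal_conjTranspose, Matrix.mulVec_diagonal, ← Complex.exp_conj,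
      ← Complex.exp_neg]

theorem phi1_eq (k l : ℝ) (a b : ℂ) (ha : a = Complex.exp (-Complex.I * k))
    (hb : b = Complex.exp (-Complex.I * l)) :
    phi1 k l = ![a / b + b / a - 2, 1 - a / b + a - b, 1 - b / a + b - a] := by
  have h1 : Complex.exp (Complex.I * (l - k)) = a / b := by
    rw [ha, hb, ← Complex.exp_sub]; congr 1; ring
  have h2 : Complex.exp (Complex.I * (k - l)) = b / a := by
    rw [ha, hb, ← Complex.exp_sub]; congr 1; ring
  have h3 : ((2 * Real.cos (k - l) - 2 : ℝ) : ℂ) = a / b + b / a - 2 := by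
    rw [← h1, ← h2]
    push_cast
    rw [Complex.two_cos]
    have e1 : ((k : ℂ) - l) * Complex.I = Complex.I * (k - l) := by ring
    have e2 : -((k : ℂ) - l) * Complex.I = Complex.I * (l - k) := by ring
    rw [e1, e2]; ring
  unfold phi1
  rw [h1, h2, h3, ← ha, ← hb]

theorem grover_walk_evolution_has_eigenvector_one :
    (∀ k l : ℝ, (Utilde k l).mulVec (phi1 k l) = phi1 k l) ∧
    (∀ k l : ℝ, (¬ ∃ n : ℤ, k - l = 2 * Real.pi * n) → phi1 k l ≠ 0) := by
  refine ⟨fun k l => ?_, fun k l hn h => hn ?_⟩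
  · obtain ⟨a, ha⟩ : ∃ a, a = Complex.exp (-Complex.I * k) := ⟨_, rfl⟩
    obtain ⟨b, hb⟩ : ∃ b, b = Complex.exp (-Complex.I * l) := ⟨_, rfl⟩
    have ha0 : a ≠ 0 := ha ▸ Complex.exp_ne_zero _
    have hb0 : b ≠ 0 := hb ▸ Complex.exp_ne_zero _
    rw [phi1_eq k l a b ha hb, Utilde, ← Matrix.mulVec_mulVec, ← Matrix.mulVec_mulVec,
      ← Matrix.mulVec_mulVec, groverCoin3_mulVec_of_sum_zero _ _ _ (by ring),
      Mkl_conj_mulVec, ← ha, ← hb,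
      groverCoin3_mulVec_of_sum_zero _ _ _ (by field_simp; ring), Mkl_mulVec, ← ha, ← hb]
    ext i
    fin_cases i <;> simp [ha0, hb0]
  · have h0 := congrFun h 0
    have h1 : 2 * Real.cos (k - l) - 2 = 0 := by
      have h2 : ((2 * Real.cos (k - l) - 2 : ℝ) : ℂ) = 0 := h0
      exact_mod_cast h2
    obtain ⟨n, hn'⟩ := (Real.cos_eq_one_iff (k - l)).1 (by linarith)
    exact ⟨n, by rw [← hn']; ring⟩
end

section
/- Let G = (1/3)·[[−1, 2, 2], [2, −1, 2], [2, 2, −1]] be the 3D Grover coin and for real k, l let M(k, l) = diag(1, e^{−ik}, e^{−il}) and Ũ(k, l) = M(k, l) · G · M(k, l)ᴴ · G. Then for all real k, l and all x ∈ ℂ, det(x·1 − Ũ(k, l)) = (x − 1)·(x² − 2c·x + 1), where c = (4cos k + 4cos l + 4cos(k − l) − 3)/9. In particular the eigenvalues of the unitary matrix Ũ(k, l) are 1, e^{iθ} and e^{−iθ}, where θ satisfies cos θ = c. -/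
open Matrix Real

/-- `c(k,l) = (4 cos k + 4 cos l + 4 cos (k - l) - 3)/9`. -/
noncomputable def cKL (k l : ℝ) : ℝ :=
  (4 * Real.cos k + 4 * Real.cos l + 4 * Real.cos (k - l) - 3) / 9

theorem grover_det (k l : ℝ) (x : ℂ) : (x • (1 : Matrix (Fin 3) (Fin 3) ℂ) - Utilde k l).det =
      (x - 1) * (x ^ 2 - 2 * (cKL k l : ℂ) * x + 1) := by
  have hM : (Mkl k l)ᴴ = Matrix.diagonal ![1, (Complex.exp (-Complex.I * k))⁻¹,
      (Complex.exp (-Complex.I * l))⁻¹] := by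
    unfold Mkl
    rw [Matrix.diagonal_conjTranspose]
    congr 1
    ext i
    fin_cases i <;> simp [← Complex.exp_conj, ← Complex.exp_neg]
  have hc : (cKL k l : ℂ) = (2 * (Complex.exp (-Complex.I * k) + (Complex.exp (-Complex.I * k))⁻¹)
      + 2 * (Complex.exp (-Complex.I * l) + (Complex.exp (-Complex.I * l))⁻¹)
      + 2 * (Complex.exp (-Complex.I * k) * (Complex.exp (-Complex.I * l))⁻¹
        + (Complex.exp (-Complex.I * k))⁻¹ * Complex.exp (-Complex.I * l)) - 3) / 9 := by
    unfold cKL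
    push_cast
    simp only [Complex.cos, ← Complex.exp_neg, ← Complex.exp_add]
    ring_nf
  unfold Utilde
  rw [hM, hc]
  unfold Mkl GroverCoin3
  have ha := Complex.exp_ne_zero (-Complex.I * k)
  have hb := Complex.exp_ne_zero (-Complex.I * l)
  generalize Complex.exp (-Complex.I * k) = a at *
  generalize Complex.exp (-Complex.I * l) = b at *
  simp [Matrix.det_fin_three, Matrix.mul_apply, Fin.sum_univ_three, Matrix.diagonal_apply,
    Matrix.one_apply]
  field_simp
  ring

theorem grover_walk_evolution_charpoly (k l : ℝ) :
    (∀ x : ℂ, (x • (1 : Matrix (Fin 3) (Fin 3) ℂ) - Utilde k l).det =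
      (x - 1) * (x ^ 2 - 2 * (cKL k l : ℂ) * x + 1)) ∧
    ∃ θ : ℝ, Real.cos θ = cKL k l ∧
      ∀ x : ℂ, (x • (1 : Matrix (Fin 3) (Fin 3) ℂ) - Utilde k l).det =
        (x - 1) * (x - Complex.exp (Complex.I * θ)) *
          (x - Complex.exp (-Complex.I * θ)) := by
  refine ⟨grover_det k l, Real.arccos (cKL k l), ?_⟩
  have h : Real.cos (Real.arccos (cKL k l)) = cKL k l := by
    apply Real.cos_arccos
    · unfold cKL
      rw [Real.cos_sub]
      nlinarith [sq_nonneg (1 + Real.cos k + Real.cos l), sq_nonneg (Real.sin k + Real.sin l),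
        Real.sin_sq_add_cos_sq k, Real.sin_sq_add_cos_sq l]
    · unfold cKL
      linarith [Real.cos_le_one k, Real.cos_le_one l, Real.cos_le_one (k - l)]
  refine ⟨h, fun x => ?_⟩
  rw [grover_det]
  generalize Real.arccos (cKL k l) = θ at *
  rw [← h]
  have h1 : Complex.exp (Complex.I * θ) * Complex.exp (-Complex.I * θ) = 1 := by
    rw [← Complex.exp_add]; simp
  have h2 : 2 * ((Real.cos θ : ℝ) : ℂ) =
      Complex.exp (Complex.I * θ) + Complex.exp (-Complex.I * θ) := by
    push_cast
    simp only [Complex.cos]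
    ring_nf
  rw [h2]
  linear_combination (-(x - 1)) * h1
end

section
/- Let φ₁(k, l) ∈ ℂ³ be the vector (2cos(k − l) − 2, 1 − e^{i(l−k)} + e^{−ik} − e^{−il}, 1 − e^{i(k−l)} + e^{−il} − e^{−ik}). Then φ₁(k, l) ≠ 0 for almost every (k, l) ∈ [−π, π]², and (1/(2π)²) · ∫∫_{[−π,π]²} (φ₁(k, l) · φ₁(k, l)ᴴ) / ‖φ₁(k, l)‖² dk dl = (1/6)·[[2, −1, −1], [−1, 2, −1], [−1, −1, 2]], where φ₁ φ₁ᴴ denotes the 3 × 3 rank-one matrix with entries φ₁(k,l)_i · conj(φ₁(k,l)_j). -/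
open Matrix Real MeasureTheory

/-- The transformation matrix `F` of the Grover walk on the honeycomb network. -/
noncomputable def Fmat : Matrix (Fin 3) (Fin 3) ℂ :=
  (1/6 : ℂ) • !![2, -1, -1; -1, 2, -1; -1, -1, 2]

/-- Entries of the normalized projector onto a vector. -/
noncomputable def projR (w : Fin 3 → ℂ) (i j : Fin 3) : ℂ :=
  (w i * (starRingEnd ℂ) (w j)) / ((∑ m, Complex.normSq (w m) : ℝ) : ℂ)

/-- The eigenvector with its scalar prefactor removed. -/
noncomputable def vv (k l : ℝ) : Fin 3 → ℂ :=
  ![Complex.exp (Complex.I * k) - Complex.exp (Complex.I * l),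
    Complex.exp (Complex.I * l) - 1, 1 - Complex.exp (Complex.I * k)]

lemma projR_smul (c : ℂ) (hc : c ≠ 0) (w w' : Fin 3 → ℂ) (σ : Fin 3 → Fin 3)
    (hσ : Function.Bijective σ)
    (h : ∀ i, w' i = c * w (σ i)) (i j : Fin 3) : projR w' i j = projR w (σ i) (σ j) := by
  unfold projR
  have hs : (∑ m, Complex.normSq (w' m)) = Complex.normSq c * ∑ m, Complex.normSq (w m) := by
    rw [← hσ.sum_comp (fun m => Complex.normSq (w m)), Finset.mul_sum]
    simp [h]
  have hc2 : ((Complex.normSq c : ℝ) : ℂ) ≠ 0 := by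
    simpa using hc
  rw [hs, h, h]
  push_cast
  rw [← mul_div_mul_left (w (σ i) * _) _ hc2, ← Complex.mul_conj, map_mul]
  congr 1
  ring

lemma projR_norm_le (w : Fin 3 → ℂ) (i j : Fin 3) : ‖projR w i j‖ ≤ 1 := by
  unfold projR
  have h0 : 0 ≤ ∑ m, Complex.normSq (w m) := Finset.sum_nonneg fun _ _ => Complex.normSq_nonneg _
  rw [norm_div, norm_mul, RCLike.norm_conj, Complex.norm_real, Real.norm_of_nonneg h0]
  apply div_le_one_of_le₀ _ h0
  have hi := Finset.single_le_sum (f := fun m => Complex.normSq (w m))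
    (fun _ _ => Complex.normSq_nonneg _) (Finset.mem_univ i)
  have hj := Finset.single_le_sum (f := fun m => Complex.normSq (w m))
    (fun _ _ => Complex.normSq_nonneg _) (Finset.mem_univ j)
  simp only [Complex.normSq_eq_norm_sq] at hi hj ⊢
  nlinarith [sq_nonneg (‖w i‖ - ‖w j‖)]

lemma projR_diag (w : Fin 3 → ℂ) (hw : w ≠ 0) : ∑ i, projR w i i = 1 := by
  unfold projR
  rw [← Finset.sum_div]
  simp only [Complex.mul_conj]
  rw [← Complex.ofReal_sum]
  apply div_self
  intro h
  apply hw
  rw [Complex.ofReal_eq_zero, Finset.sum_eq_zero_iff_of_nonneg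
    (fun _ _ => Complex.normSq_nonneg _)] at h
  funext i
  simpa using h i (Finset.mem_univ i)

lemma projR_row (w : Fin 3 → ℂ) (hw : ∑ i, w i = 0) (i : Fin 3) : ∑ j, projR w i j = 0 := by
  unfold projR
  rw [← Finset.sum_div, ← Finset.mul_sum, ← map_sum, hw]
  simp

lemma vv_sum (k l : ℝ) : ∑ i, vv k l i = 0 := by
  simp [vv, Fin.sum_univ_three]

lemma vv_cont : Continuous fun p : ℝ × ℝ => vv p.1 p.2 := by
  unfold vv
  apply continuous_pi
  intro i
  fin_cases i <;> simp <;> fun_prop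

lemma phi1_cont : Continuous fun p : ℝ × ℝ => phi1 p.1 p.2 := by
  unfold phi1
  apply continuous_pi
  intro i
  fin_cases i <;> simp <;> fun_prop

lemma projR_meas (i j : Fin 3) : Measurable fun w : Fin 3 → ℂ => projR w i j := by
  unfold projR
  apply Measurable.div
  · exact Continuous.measurable (by fun_prop)
  · apply Continuous.measurable
    have := Complex.continuous_normSq
    fun_prop

lemma phi1_eq_s8 (k l : ℝ) (i : Fin 3) : phi1 k l i =
    ((Complex.exp (Complex.I * k) - Complex.exp (Complex.I * l)) *
      (Complex.exp (-Complex.I * k) * Complex.exp (-Complex.I * l))) * vv k l i := by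
  have hx : Complex.exp (Complex.I * k) ≠ 0 := Complex.exp_ne_zero _
  have hy : Complex.exp (Complex.I * l) ≠ 0 := Complex.exp_ne_zero _
  fin_cases i
  · simp only [phi1, vv, Complex.ofReal_sub, Complex.ofReal_mul, Complex.ofReal_cos, Complex.cos,
      Fin.zero_eta, Matrix.cons_val_zero]
    rw [show ((k:ℂ) - l) * Complex.I = Complex.I * k - Complex.I * l by ring,
      show -((k:ℂ) - l) * Complex.I = Complex.I * l - Complex.I * k by ring]
    simp only [neg_mul, Complex.exp_neg, Complex.exp_sub, Complex.ofReal_ofNat]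
    field_simp
    ring
  · simp [phi1, vv, mul_sub, Complex.exp_neg, Complex.exp_sub]
    field_simp
    ring
  · simp [phi1, vv, mul_sub, Complex.exp_neg, Complex.exp_sub]
    field_simp
    ring

lemma ae_cos : ∀ᵐ p : ℝ × ℝ, Real.cos (p.1 - p.2) ≠ 1 := by
  have hm : MeasurableSet {p : ℝ × ℝ | Real.cos (p.1 - p.2) = 1} :=
    (isClosed_eq (by fun_prop) continuous_const).measurableSet
  rw [ae_iff]
  simp only [not_not]
  rw [Measure.volume_eq_prod, Measure.measure_prod_null hm]
  refine Filter.Eventually.of_forall fun k => ?_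
  apply Set.Countable.measure_zero
  apply (Set.countable_range (fun n : ℤ => k - n * (2 * π))).mono
  intro l hl
  obtain ⟨n, hn⟩ := (Real.cos_eq_one_iff _).1 hl
  exact ⟨n, by simp only at hn ⊢; linarith⟩

lemma phi1_zero_ne (k l : ℝ) (h : Real.cos (k - l) ≠ 1) : phi1 k l 0 ≠ 0 := by
  simp only [phi1, Matrix.cons_val_zero]
  rw [Ne, Complex.ofReal_eq_zero]
  intro h'
  apply h
  linarith

/-- Lebesgue measure on one period. -/
noncomputable def mu0 : Measure ℝ := volume.restrict (Set.Ioc (-π) π)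

instance : IsFiniteMeasure mu0 := by unfold mu0; infer_instance

lemma ae_cos' : ∀ᵐ p : ℝ × ℝ ∂(mu0.prod mu0), Real.cos (p.1 - p.2) ≠ 1 := by
  unfold mu0
  rw [Measure.prod_restrict]
  exact ae_restrict_of_ae ae_cos

lemma integ (f : ℝ × ℝ → Fin 3 → ℂ) (hf : Continuous f) (i j : Fin 3) :
    Integrable (fun p => projR (f p) i j) (mu0.prod mu0) :=
  Integrable.of_bound ((projR_meas i j).comp hf.measurable).aestronglyMeasurable 1
    (Filter.Eventually.of_forall fun _ => projR_norm_le _ _ _)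

/-- The integrated projector. -/
noncomputable def JJ (i j : Fin 3) : ℂ := ∫ p, projR (vv p.1 p.2) i j ∂(mu0.prod mu0)

lemma JJ_iter (i j : Fin 3) : JJ i j = ∫ k in (-π)..π, ∫ l in (-π)..π, projR (vv k l) i j := by
  have h : -π ≤ π := by linarith [Real.pi_pos]
  simp only [intervalIntegral.integral_of_le h]
  exact integral_prod _ (integ _ vv_cont i j)

lemma JJ_swap' (i j : Fin 3) : JJ i j = ∫ k in (-π)..π, ∫ l in (-π)..π, projR (vv l k) i j := by
  have h : -π ≤ π := by linarith [Real.pi_pos]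
  simp only [intervalIntegral.integral_of_le h]
  exact integral_prod_symm _ (integ _ vv_cont i j)

lemma phi_iter (i j : Fin 3) :
    ∫ k in (-π)..π, ∫ l in (-π)..π, projR (phi1 k l) i j = JJ i j := by
  have h : -π ≤ π := by linarith [Real.pi_pos]
  simp only [intervalIntegral.integral_of_le h]
  refine (integral_prod _ (integ _ phi1_cont i j)).symm.trans ?_
  apply integral_congr_ae
  filter_upwards [ae_cos'] with p hp
  have h0 := phi1_zero_ne _ _ hp
  have he := phi1_eq_s8 p.1 p.2
  refine projR_smul _ ?_ _ _ id Function.bijective_id he i j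
  intro hc
  apply h0
  rw [he, hc, zero_mul]

lemma JJ_swap (i j : Fin 3) : JJ i j = JJ (Equiv.swap 1 2 i) (Equiv.swap 1 2 j) := by
  rw [JJ_iter, JJ_swap']
  congr 1; funext k; congr 1; funext l
  refine projR_smul (-1) (by simp) _ _ _ (Equiv.swap 1 2).bijective ?_ i j
  intro i
  fin_cases i
  · simp [vv, Equiv.swap_apply_of_ne_of_ne]
  · simp [vv]
  · simp [vv]

lemma vv_periodic (k : ℝ) (i j : Fin 3) :
    Function.Periodic (fun l => projR (vv l k) i j) (2 * π) := by
  intro l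
  have : vv (l + 2 * π) k = vv l k := by
    have h : Complex.exp (Complex.I * ((l + 2 * π : ℝ) : ℂ)) = Complex.exp (Complex.I * l) := by
      push_cast
      rw [show Complex.I * ((l:ℂ) + 2 * π) = Complex.I * l + 2 * π * Complex.I by ring]
      exact Complex.exp_periodic _
    simp only [vv, h]
  simp only [this]

lemma JJ_cyc (i j : Fin 3) : JJ i j = JJ (i + 1) (j + 1) := by
  have h1 : JJ i j = ∫ k in (-π)..π, ∫ l in (-π)..π, projR (vv l (-k)) i j := by
    rw [JJ_swap']
    have := intervalIntegral.integral_comp_neg (a := -π) (b := π)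
      (fun k => ∫ l in (-π)..π, projR (vv l k) i j)
    rw [this, neg_neg]
  have h2 : ∀ k : ℝ, ∫ l in (-π)..π, projR (vv l (-k)) i j
      = ∫ l in (-π)..π, projR (vv (l - k) (-k)) i j := by
    intro k
    have e1 := intervalIntegral.integral_comp_sub_right (a := -π) (b := π)
      (fun l => projR (vv l (-k)) i j) k
    rw [e1]
    have := (vv_periodic (-k) i j).intervalIntegral_add_eq (-π) (-π - k)
    rwa [show -π + 2 * π = π by ring, show -π - k + 2 * π = π - k by ring] at this
  rw [h1, JJ_iter]
  simp only [h2]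
  congr 1; funext k; congr 1; funext l
  refine projR_smul (Complex.exp (-(Complex.I * k))) (Complex.exp_ne_zero _) _ _ (fun i => i + 1)
    (Equiv.addRight (1 : Fin 3)).bijective ?_ i j
  intro i
  have hx : Complex.exp (Complex.I * k) ≠ 0 := Complex.exp_ne_zero _
  fin_cases i <;>
  · simp [vv, mul_sub, Complex.exp_neg, Complex.exp_sub]
    try field_simp

lemma JJ_row (i : Fin 3) : JJ i 0 + JJ i 1 + JJ i 2 = 0 := by
  have : ∑ j, JJ i j = 0 := by
    unfold JJ
    rw [← integral_finsetSum _ (fun j _ => integ _ vv_cont i j)]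
    simp [projR_row _ (vv_sum _ _)]
  simpa [Fin.sum_univ_three] using this

lemma JJ_diag : JJ 0 0 + JJ 1 1 + JJ 2 2 = (2 * π) ^ 2 := by
  have : ∑ i, JJ i i = (2 * π) ^ 2 := by
    unfold JJ
    rw [← integral_finsetSum _ (fun i _ => integ _ vv_cont i i)]
    have : ∫ p, ∑ i, projR (vv p.1 p.2) i i ∂(mu0.prod mu0) = ∫ p, (1:ℂ) ∂(mu0.prod mu0) := by
      apply integral_congr_ae
      filter_upwards [ae_cos'] with p hp
      apply projR_diag
      intro h
      apply phi1_zero_ne _ _ hp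
      rw [phi1_eq_s8, h]
      simp
    rw [this, integral_const]
    have hm : (mu0.prod mu0).real Set.univ = (2 * π) ^ 2 := by
      rw [← Set.univ_prod_univ, measureReal_prod_prod]
      have : mu0.real Set.univ = 2 * π := by
        simp only [mu0, measureReal_restrict_apply_univ, Real.volume_real_Ioc]
        rw [max_eq_left] <;> linarith [Real.pi_pos]
      rw [this, sq]
    rw [hm]
    simp
  simpa [Fin.sum_univ_three] using this

theorem integral_normalized_projector_eq_F :
    (∀ᵐ p : ℝ × ℝ ∂(volume.restrict (Set.Icc (-Real.pi) Real.pi ×ˢ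
        Set.Icc (-Real.pi) Real.pi)), phi1 p.1 p.2 ≠ 0) ∧
    ∀ i j : Fin 3,
      (1 / (2 * Real.pi) ^ 2 : ℂ) *
        ∫ k in (-Real.pi)..Real.pi, ∫ l in (-Real.pi)..Real.pi,
          (phi1 k l i * (starRingEnd ℂ) (phi1 k l j)) /
            ((∑ m, Complex.normSq (phi1 k l m) : ℝ) : ℂ)
      = Fmat i j := by

  refine ⟨?_, ?_⟩
  · apply ae_restrict_of_ae
    filter_upwards [ae_cos] with p hp h
    apply phi1_zero_ne _ _ hp
    rw [h]
    rfl
  · intro i j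
    have hJ := phi_iter i j
    unfold projR at hJ
    rw [hJ]
    have hpi : (π : ℂ) ≠ 0 := by exact_mod_cast Real.pi_ne_zero
    have c00 : JJ 0 0 = JJ 1 1 := JJ_cyc 0 0
    have c11 : JJ 1 1 = JJ 2 2 := JJ_cyc 1 1
    have c01 : JJ 0 1 = JJ 1 2 := JJ_cyc 0 1
    have c12 : JJ 1 2 = JJ 2 0 := JJ_cyc 1 2
    have c10 : JJ 1 0 = JJ 2 1 := JJ_cyc 1 0
    have c21 : JJ 2 1 = JJ 0 2 := JJ_cyc 2 1
    have s12 : JJ 1 2 = JJ 2 1 := by simpa using JJ_swap 1 2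
    have r0 := JJ_row 0
    have d := JJ_diag
    have hd : JJ 0 0 = (2 * π) ^ 2 / 3 := by linear_combination (d + 2 * c00 + c11) / 3
    have ho : JJ 0 1 = -(2 * π) ^ 2 / 6 := by
      linear_combination (r0 - hd + c01 + s12 + c21) / 2
    have key : ∀ i j : Fin 3, JJ i j = (2 * π) ^ 2 * Fmat i j := by
      intro i j
      fin_cases i <;> fin_cases j <;> simp [Fmat]
      · linear_combination hd
      · linear_combination ho
      · linear_combination ho - c01 - s12 - c21
      · linear_combination ho - c01 - s12 - c10 + 2 * c10
      · linear_combination hd - c00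
      · linear_combination ho - c01
      · linear_combination ho - c01 - c12
      · linear_combination ho - c01 - s12
      · linear_combination hd - c00 - c11
    rw [key]
    field_simp
end

section
/- Let G = (1/3)·[[−1, 2, 2], [2, −1, 2], [2, 2, −1]] be the 3D Grover coin and for real k, l let M(k, l) = diag(1, e^{−ik}, e^{−il}) and Ũ(k, l) = M(k, l) · G · M(k, l)ᴴ · G. Then the limit, as the positive integer n tends to infinity, of the matrix-valued integrals (1/(2π)²) · ∫∫_{[−π,π]²} (Ũ(k, l))ⁿ dk dl exists and equals F = (1/6)·[[2, −1, −1], [−1, 2, −1], [−1, −1, 2]] (regarded as a complex matrix). Consequently, for the Grover walk on the honeycomb network started at the origin with coin state v ∈ ℂ³, the amplitude at the origin after 2n steps converges to F·v as n → ∞. -/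
open Matrix Real MeasureTheory Filter

/-- Algebraic form of the evolution operator. -/
noncomputable def Ualg (x y : ℂ) : Matrix (Fin 3) (Fin 3) ℂ :=
  Matrix.diagonal ![1, x, y] * GroverCoin3 * Matrix.diagonal ![1, x⁻¹, y⁻¹] * GroverCoin3

/-- The unnormalized projection on the fixed vector. -/
noncomputable def Walg (x y : ℂ) : Matrix (Fin 3) (Fin 3) ℂ :=
  Matrix.vecMulVec ![x⁻¹ - y⁻¹, y⁻¹ - 1, 1 - x⁻¹] ![x - y, y - 1, 1 - x]

/-- Twice the cosine of the phase. -/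
noncomputable def tc (x y : ℂ) : ℂ :=
  (4/9) * (3 + x + x⁻¹ + y + y⁻¹ + x * y⁻¹ + y * x⁻¹) - 2

/-- Explicit entries; `a = (1,x,y)`. -/
lemma Ualg_explicit (x y : ℂ) (hx : x ≠ 0) (hy : y ≠ 0) :
    Ualg x y = (1/9 : ℂ) • !![
      1 + 4 * x⁻¹ + 4 * y⁻¹, -2 - 2 * x⁻¹ + 4 * y⁻¹, -2 + 4 * x⁻¹ - 2 * y⁻¹;
      -2 * x - 2 + 4 * x * y⁻¹, 4 * x + 1 + 4 * x * y⁻¹, 4 * x - 2 - 2 * x * y⁻¹;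
      -2 * y + 4 * y * x⁻¹ - 2, 4 * y - 2 * y * x⁻¹ - 2, 4 * y + 4 * y * x⁻¹ + 1] := by
  ext i j
  fin_cases i <;> fin_cases j <;>
    simp [Ualg, GroverCoin3, Matrix.mul_apply, Fin.sum_univ_three, Matrix.diagonal] <;>
    field_simp <;> ring

lemma Ualg_sq (x y : ℂ) (hx : x ≠ 0) (hy : y ≠ 0) :
    Ualg x y * Ualg x y = tc x y • Ualg x y - 1 + (4/9 : ℂ) • Walg x y := by
  rw [Ualg_explicit x y hx hy]
  ext i j
  fin_cases i <;> fin_cases j <;>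
    simp [tc, Walg, Matrix.mul_apply, Fin.sum_univ_three, Matrix.vecMulVec_apply] <;>
    field_simp <;> ring

lemma Ualg_mul_W (x y : ℂ) (hx : x ≠ 0) (hy : y ≠ 0) :
    Ualg x y * Walg x y = Walg x y := by
  rw [Ualg_explicit x y hx hy]
  ext i j
  fin_cases i <;> fin_cases j <;>
    simp [Walg, Matrix.mul_apply, Fin.sum_univ_three, Matrix.vecMulVec_apply] <;>
    field_simp <;> ring

lemma Ualg_pow_mul_W (x y : ℂ) (hx : x ≠ 0) (hy : y ≠ 0) (n : ℕ) :
    Ualg x y ^ n * Walg x y = Walg x y := by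
  induction n with
  | zero => simp
  | succ n ih => rw [pow_succ, mul_assoc, Ualg_mul_W x y hx hy, ih]

lemma Ualg_pow_rec (x y : ℂ) (hx : x ≠ 0) (hy : y ≠ 0) (n : ℕ) :
    Ualg x y ^ (n+2) = tc x y • Ualg x y ^ (n+1) - Ualg x y ^ n + (4/9 : ℂ) • Walg x y := by
  rw [pow_add, pow_two, Ualg_sq x y hx hy, mul_add, mul_sub, mul_smul_comm, mul_smul_comm,
    Ualg_pow_mul_W x y hx hy, pow_succ, mul_one]

lemma trace_W (x y : ℂ) (hx : x ≠ 0) (hy : y ≠ 0) :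
    (4/9 : ℂ) * (Walg x y).trace = 2 - tc x y := by
  simp [Walg, tc, Matrix.trace, Fin.sum_univ_three, Matrix.vecMulVec_apply]
  field_simp
  ring

lemma trace_pow (x y : ℂ) (hx : x ≠ 0) (hy : y ≠ 0) (φ : ℝ) (h : tc x y = 2 * (Real.cos φ : ℝ))
    (n : ℕ) : (Ualg x y ^ n).trace = 1 + 2 * (Real.cos (n * φ) : ℝ) ∧
      (Ualg x y ^ (n+1)).trace = 1 + 2 * (Real.cos ((n+1 : ℕ) * φ) : ℝ) := by
  induction n with
  | zero =>
    refine ⟨by simp [Matrix.trace, Fin.sum_univ_three]; norm_num, ?_⟩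
    have : (Ualg x y).trace = 1 + tc x y := by
      rw [Ualg_explicit x y hx hy]
      simp [tc, Matrix.trace, Fin.sum_univ_three]
      field_simp
      ring
    simp only [zero_add, pow_one, this, h, Nat.cast_one, one_mul]
  | succ n ih =>
    refine ⟨ih.2, ?_⟩
    rw [Ualg_pow_rec x y hx hy, Matrix.trace_add, Matrix.trace_sub, Matrix.trace_smul,
      Matrix.trace_smul, ih.1, ih.2, smul_eq_mul, smul_eq_mul, trace_W x y hx hy, h]
    have : Real.cos ((n+1+1 : ℕ) * φ)
        = 2 * Real.cos φ * Real.cos ((n+1 : ℕ) * φ) - Real.cos (n * φ) := by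
      have e1 : ((n+1+1 : ℕ) : ℝ) * φ = (n+1 : ℕ) * φ + φ := by push_cast; ring
      have e2 : (n : ℝ) * φ = (n+1 : ℕ) * φ - φ := by push_cast; ring
      rw [e1, e2, Real.cos_add, Real.cos_sub]; ring
    rw [this]
    push_cast
    ring

lemma total_pow (x y : ℂ) (hx : x ≠ 0) (hy : y ≠ 0) (φ : ℝ) (h : tc x y = 2 * (Real.cos φ : ℝ))
    (n : ℕ) : ∑ i, ∑ j, (Ualg x y ^ n) i j = 3 * (Real.cos (n * φ) : ℝ) ∧
      ∑ i, ∑ j, (Ualg x y ^ (n+1)) i j = 3 * (Real.cos ((n+1 : ℕ) * φ) : ℝ) := by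
  induction n with
  | zero =>
    refine ⟨by simp [Matrix.one_apply], ?_⟩
    have : 2 * ∑ i, ∑ j, (Ualg x y) i j = 3 * tc x y := by
      rw [Ualg_explicit x y hx hy]
      simp [tc, Fin.sum_univ_three]
      field_simp
      ring
    simp only [zero_add, pow_one, Nat.cast_one, one_mul]
    rw [h] at this
    linear_combination this / 2
  | succ n ih =>
    refine ⟨ih.2, ?_⟩
    rw [Ualg_pow_rec x y hx hy]
    have hW : ∑ i, ∑ j, (Walg x y) i j = 0 := by
      simp [Walg, Fin.sum_univ_three, Matrix.vecMulVec_apply]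
      ring
    simp only [Matrix.add_apply, Matrix.sub_apply, Matrix.smul_apply, Finset.sum_add_distrib,
      Finset.sum_sub_distrib, ← Finset.smul_sum, ih.1, ih.2, hW, h]
    have : Real.cos ((n+1+1 : ℕ) * φ)
        = 2 * Real.cos φ * Real.cos ((n+1 : ℕ) * φ) - Real.cos (n * φ) := by
      have e1 : ((n+1+1 : ℕ) : ℝ) * φ = (n+1 : ℕ) * φ + φ := by push_cast; ring
      have e2 : (n : ℝ) * φ = (n+1 : ℕ) * φ - φ := by push_cast; ring
      rw [e1, e2, Real.cos_add, Real.cos_sub]; ring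
    rw [this, smul_eq_mul, smul_eq_mul]
    push_cast
    ring

lemma Utilde_eq (k l : ℝ) :
    Utilde k l = Ualg (Complex.exp (-Complex.I * k)) (Complex.exp (-Complex.I * l)) := by
  have : (Mkl k l)ᴴ = Matrix.diagonal ![1, (Complex.exp (-Complex.I * k))⁻¹,
      (Complex.exp (-Complex.I * l))⁻¹] := by
    rw [Mkl, Matrix.diagonal_conjTranspose]
    congr 1
    ext i
    fin_cases i <;> simp [← Complex.exp_conj, ← Complex.exp_neg]
  rw [Utilde, this, Ualg, Mkl]

lemma Ualg_swap12 (x y : ℂ) (hx : x ≠ 0) (hy : y ≠ 0) :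
    (Ualg x y).submatrix (Equiv.swap (1 : Fin 3) 2) (Equiv.swap (1 : Fin 3) 2) = Ualg y x := by
  rw [Ualg_explicit x y hx hy, Ualg_explicit y x hy hx]
  ext i j
  have h0 : Equiv.swap (1 : Fin 3) 2 0 = 0 := by decide
  fin_cases i <;> fin_cases j <;> simp [h0] <;> ring

lemma Ualg_swap01 (x y : ℂ) (hx : x ≠ 0) (hy : y ≠ 0) :
    (Ualg x y).submatrix (Equiv.swap (0 : Fin 3) 1) (Equiv.swap (0 : Fin 3) 1)
      = Ualg x⁻¹ (y * x⁻¹) := by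
  rw [Ualg_explicit x y hx hy, Ualg_explicit _ _ (by positivity) (by positivity)]
  ext i j
  have h0 : Equiv.swap (0 : Fin 3) 1 2 = 2 := by decide
  fin_cases i <;> fin_cases j <;> simp [h0] <;> field_simp <;> ring

lemma submatrix_pow_equiv (A : Matrix (Fin 3) (Fin 3) ℂ) (e : Equiv.Perm (Fin 3)) (n : ℕ) :
    (A ^ n).submatrix e e = (A.submatrix e e) ^ n := by
  induction n with
  | zero => simp
  | succ n ih => rw [pow_succ, pow_succ, ← ih, Matrix.submatrix_mul_equiv]

lemma Utilde_pow_swap12 (k l : ℝ) (n : ℕ) (i j : Fin 3) :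
    (Utilde k l ^ n) (Equiv.swap (1 : Fin 3) 2 i) (Equiv.swap (1 : Fin 3) 2 j)
      = (Utilde l k ^ n) i j := by
  have := submatrix_pow_equiv (Utilde k l) (Equiv.swap (1 : Fin 3) 2) n
  rw [Utilde_eq, Ualg_swap12 _ _ (Complex.exp_ne_zero _) (Complex.exp_ne_zero _), ← Utilde_eq,
    ← Utilde_eq] at this
  rw [← this, Matrix.submatrix_apply]

lemma Utilde_pow_swap01 (k l : ℝ) (n : ℕ) (i j : Fin 3) :
    (Utilde k l ^ n) (Equiv.swap (0 : Fin 3) 1 i) (Equiv.swap (0 : Fin 3) 1 j)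
      = (Utilde (-k) (l - k) ^ n) i j := by
  have := submatrix_pow_equiv (Utilde k l) (Equiv.swap (0 : Fin 3) 1) n
  have h2 : Utilde (-k) (l - k) = Ualg (Complex.exp (-Complex.I * k))⁻¹
      (Complex.exp (-Complex.I * l) * (Complex.exp (-Complex.I * k))⁻¹) := by
    rw [Utilde_eq, ← Complex.exp_neg, ← Complex.exp_add]
    congr 2 <;> push_cast <;> ring
  rw [Utilde_eq, Ualg_swap01 _ _ (Complex.exp_ne_zero _) (Complex.exp_ne_zero _), ← h2,
    ← Utilde_eq] at this
  rw [← this, Matrix.submatrix_apply]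

/-- Cosine of the phase. -/
noncomputable def cph (k l : ℝ) : ℝ :=
  (2/9) * (3 + 2 * Real.cos k + 2 * Real.cos l + 2 * Real.cos (k - l)) - 1

lemma cph_shift (k l : ℝ) : cph k (l + k/2) =
    (2/9) * (4 * Real.cos (k/2) ^ 2 + 4 * Real.cos (k/2) * Real.cos l + 1) - 1 := by
  have h1 : Real.cos k = 2 * Real.cos (k/2) ^ 2 - 1 := by rw [← Real.cos_two_mul]; congr 1; ring
  have h2 : Real.cos (k - (l + k/2)) = Real.cos (k/2 - l) := by congr 1; ring
  rw [cph, h1, h2, Real.cos_add, Real.cos_sub]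
  ring

lemma cph_mem (k l : ℝ) : -1 ≤ cph k l ∧ cph k l ≤ 1 := by
  have h := cph_shift k (l - k/2)
  rw [sub_add_cancel] at h
  set C := Real.cos (k/2)
  set D := Real.cos (l - k/2)
  have hC1 : C ≤ 1 := Real.cos_le_one _
  have hC2 : -1 ≤ C := Real.neg_one_le_cos _
  have hD1 : D ≤ 1 := Real.cos_le_one _
  have hD2 : -1 ≤ D := Real.neg_one_le_cos _
  rw [h]
  constructor <;> nlinarith [sq_nonneg (2 * C + D), mul_nonneg (sub_nonneg.2 hC1) (sub_nonneg.2 hD1),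
    mul_nonneg (sub_nonneg.2 hC1) (neg_le_iff_add_nonneg.1 hC2),
    mul_nonneg (sub_nonneg.2 hD1) (neg_le_iff_add_nonneg.1 hD2),
    mul_nonneg (neg_le_iff_add_nonneg.1 hC2) (neg_le_iff_add_nonneg.1 hD2),
    mul_nonneg (sub_nonneg.2 hC1) (neg_le_iff_add_nonneg.1 hD2),
    mul_nonneg (sub_nonneg.2 hD1) (neg_le_iff_add_nonneg.1 hC2)]

/-- The phase. -/
noncomputable def ph (k l : ℝ) : ℝ := Real.arccos (cph k l)

lemma tc_eq (k l : ℝ) :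
    tc (Complex.exp (-Complex.I * k)) (Complex.exp (-Complex.I * l))
      = 2 * (Real.cos (ph k l) : ℝ) := by
  rw [ph, Real.cos_arccos (cph_mem k l).1 (cph_mem k l).2, tc, cph]
  push_cast
  rw [Complex.cos, Complex.cos, Complex.cos]
  simp only [← Complex.exp_neg, ← Complex.exp_add]
  have e1 : -Complex.I * (k:ℂ) + -(-Complex.I * l) = -((k:ℂ) - l) * Complex.I := by ring
  have e2 : -Complex.I * (l:ℂ) + -(-Complex.I * k) = ((k:ℂ) - l) * Complex.I := by ring
  have e3 (t : ℂ) : -(-Complex.I * t) = t * Complex.I := by ring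
  have e4 (t : ℂ) : (-Complex.I * t) = - t * Complex.I := by ring
  rw [e1, e2, e3, e3, e4, e4]
  ring

lemma Utilde_trace (k l : ℝ) (n : ℕ) :
    ∑ i, (Utilde k l ^ n) i i = 1 + 2 * (Real.cos (n * ph k l) : ℝ) := by
  rw [Utilde_eq]
  exact (trace_pow _ _ (Complex.exp_ne_zero _) (Complex.exp_ne_zero _) _ (tc_eq k l) n).1

lemma Utilde_total (k l : ℝ) (n : ℕ) :
    ∑ i, ∑ j, (Utilde k l ^ n) i j = 3 * (Real.cos (n * ph k l) : ℝ) := by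
  rw [Utilde_eq]
  exact (total_pow _ _ (Complex.exp_ne_zero _) (Complex.exp_ne_zero _) _ (tc_eq k l) n).1

/-- Riemann-Lebesgue after a change of variables. -/
lemma rl_cov (s : Set ℝ) (hs : MeasurableSet s) (φ φ' : ℝ → ℝ)
    (hd : ∀ x ∈ s, HasDerivWithinAt φ (φ' x) s x) (hinj : Set.InjOn φ s)
    (hne : ∀ x ∈ s, φ' x ≠ 0) :
    Tendsto (fun n : ℕ => ∫ l in s, Complex.exp (-(n * φ l : ℝ) * Complex.I)) atTop (nhds 0) := by
  classical
  let ψ := Function.invFunOn φ s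
  let ρ : ℝ → ℂ := (φ '' s).indicator (fun t => ((|φ' (ψ t)|⁻¹ : ℝ) : ℂ))
  have hψ : ∀ x ∈ s, ψ (φ x) = x := fun x hx => hinj.leftInvOn_invFunOn hx
  have hms : MeasurableSet (φ '' s) := measurable_image_of_fderivWithin hs
    (fun x hx => (hd x hx).hasFDerivWithinAt) hinj
  have key : ∀ n : ℕ, ∫ l in s, Complex.exp (-(n * φ l : ℝ) * Complex.I)
      = ∫ v : ℝ, Real.fourierChar (-(v * ((n : ℝ) / (2 * Real.pi)))) • ρ v := by
    intro n
    have h1 : (fun v : ℝ => Real.fourierChar (-(v * ((n : ℝ) / (2 * Real.pi)))) • ρ v)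
        = (φ '' s).indicator (fun t =>
          Complex.exp (-(n * t : ℝ) * Complex.I) * ((|φ' (ψ t)|⁻¹ : ℝ) : ℂ)) := by
      ext v
      simp only [ρ, Circle.smul_def, Real.fourierChar_apply, smul_eq_mul, Set.indicator_apply]
      split_ifs
      · congr 3
        have : (Real.pi : ℂ) ≠ 0 := by exact_mod_cast Real.pi_ne_zero
        push_cast
        field_simp
      · simp
    rw [h1, integral_indicator hms, integral_image_eq_integral_abs_deriv_smul hs hd hinj]
    refine setIntegral_congr_fun hs fun x hx => ?_
    have h2 : ((|φ' x| : ℝ) : ℂ) ≠ 0 := by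
      exact_mod_cast abs_ne_zero.2 (hne x hx)
    simp only [hψ x hx, Complex.real_smul]
    push_cast
    field_simp
  simp_rw [key]
  refine (Real.tendsto_integral_exp_smul_cocompact ρ).comp ?_
  refine Tendsto.mono_right ?_ atTop_le_cocompact
  exact tendsto_natCast_atTop_atTop.atTop_div_const (by positivity)

lemma continuous_cph : Continuous (fun p : ℝ × ℝ => cph p.1 p.2) := by
  unfold cph; fun_prop

lemma continuous_ph : Continuous (fun p : ℝ × ℝ => ph p.1 p.2) :=
  Real.continuous_arccos.comp continuous_cph

lemma ph_periodic (k : ℝ) : Function.Periodic (ph k) (2 * Real.pi) := by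
  intro l
  have : k - (l + 2 * Real.pi) = (k - l) - 2 * Real.pi := by ring
  simp [ph, cph, this]

lemma periodic_shift {E : Type*} [NormedAddCommGroup E] [NormedSpace ℝ E] (f : ℝ → E)
    (hf : Function.Periodic f (2 * Real.pi))
    (c : ℝ) : ∫ l in (-Real.pi)..Real.pi, f (l + c) = ∫ l in (-Real.pi)..Real.pi, f l := by
  rw [intervalIntegral.integral_comp_add_right]
  have := hf.intervalIntegral_add_eq (-Real.pi + c) (-Real.pi)
  have e1 : -Real.pi + c + 2 * Real.pi = Real.pi + c := by ring
  have e2 : -Real.pi + 2 * Real.pi = Real.pi := by ring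
  rwa [e1, e2] at this

lemma inner_tendsto (k : ℝ) (hk : k ∈ Set.Ioo (-Real.pi) Real.pi) :
    Tendsto (fun n : ℕ => ∫ l in (-Real.pi)..Real.pi, Real.cos (n * ph k l)) atTop (nhds 0) := by
  set C := Real.cos (k/2) with hC
  have hC0 : 0 < C := Real.cos_pos_of_mem_Ioo ⟨by linarith [hk.1], by linarith [hk.2]⟩
  have hC1 : C ≤ 1 := Real.cos_le_one _
  let p : ℝ → ℝ := fun l => (2/9) * (4 * C ^ 2 + 4 * C * Real.cos l + 1) - 1
  let φ : ℝ → ℝ := fun l => Real.arccos (p l)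
  have hpm : ∀ l ∈ Set.Ioo 0 Real.pi, -1 < p l ∧ p l < 1 := by
    intro l hl
    have hs : 0 < Real.sin l := Real.sin_pos_of_mem_Ioo hl
    have hsc := Real.sin_sq_add_cos_sq l
    have hc1 : Real.cos l < 1 := by nlinarith [Real.cos_le_one l]
    simp only [p]
    constructor
    · nlinarith [sq_nonneg (2 * C + Real.cos l), mul_pos hs hs]
    · nlinarith [mul_pos hC0 (sub_pos.2 hc1), mul_nonneg hC0.le (sub_nonneg.2 hC1)]
  have hpd : ∀ l, HasDerivAt p ((2/9) * (4 * C * (-Real.sin l))) l := by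
    intro l
    exact ((((Real.hasDerivAt_cos l).const_mul (4 * C)).const_add (4 * C ^ 2)).add_const 1
      |>.const_mul (2/9)).sub_const 1
  have hφc : Continuous φ := by
    refine Real.continuous_arccos.comp ?_
    simp only [p]; fun_prop
  have h1 := rl_cov (Set.Ioo 0 Real.pi) measurableSet_Ioo φ
    (fun l => -(1 / √(1 - p l ^ 2)) * ((2/9) * (4 * C * (-Real.sin l))))
    (fun l hl => ((Real.hasDerivAt_arccos (hpm l hl).1.ne' (hpm l hl).2.ne).comp l
      (hpd l)).hasDerivWithinAt)
    (by
      intro a ha b hb hab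
      have h2 : p a = p b := Real.arccos_injOn ⟨(hpm a ha).1.le, (hpm a ha).2.le⟩
        ⟨(hpm b hb).1.le, (hpm b hb).2.le⟩ hab
      have h3 : Real.cos a = Real.cos b := by
        simp only [p] at h2
        have : C * Real.cos a = C * Real.cos b := by linarith
        exact mul_left_cancel₀ hC0.ne' this
      exact Real.injOn_cos ⟨ha.1.le, ha.2.le⟩ ⟨hb.1.le, hb.2.le⟩ h3)
    (by
      intro l hl
      have hs : 0 < Real.sin l := Real.sin_pos_of_mem_Ioo hl
      have h4 : 0 < √(1 - p l ^ 2) := Real.sqrt_pos.2 (by nlinarith [hpm l hl])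
      have h5 : 0 < 1 / √(1 - p l ^ 2) * ((2/9) * (4 * C * Real.sin l)) := by positivity
      intro h6
      linarith)
  have h2 : ∀ n : ℕ, ∫ l in (-Real.pi)..Real.pi, Real.cos (n * ph k l)
      = 2 * (∫ l in Set.Ioo 0 Real.pi, Complex.exp (-(n * φ l : ℝ) * Complex.I)).re := by
    intro n
    have e1 := periodic_shift (fun l => Real.cos (n * ph k l))
      (fun l => by simp only [ph_periodic k l]) (k/2)
    rw [← e1]
    have e2 : ∀ l, ph k (l + k/2) = φ l := fun l => by rw [ph, cph_shift]
    simp only [e2]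
    have hint : ∀ a b : ℝ, IntervalIntegrable (fun l => Real.cos (n * φ l)) volume a b :=
      fun a b => (Continuous.intervalIntegrable (by fun_prop) _ _)
    rw [← intervalIntegral.integral_add_adjacent_intervals (hint (-Real.pi) 0) (hint 0 Real.pi)]
    have e3 : ∫ l in (-Real.pi)..0, Real.cos (n * φ l) = ∫ l in (0:ℝ)..Real.pi, Real.cos (n * φ l) := by
      have := intervalIntegral.integral_comp_neg (a := 0) (b := Real.pi)
        (fun l => Real.cos (n * φ l))
      rw [neg_zero] at this
      rw [← this]
      simp only [φ, p, Real.cos_neg]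
    rw [e3, ← two_mul, intervalIntegral.integral_of_le Real.pi_pos.le, integral_Ioc_eq_integral_Ioo]
    congr 1
    have hi : Integrable (fun l => Complex.exp (-(n * φ l : ℝ) * Complex.I))
        (volume.restrict (Set.Ioo 0 Real.pi)) := by
      have : Continuous (fun l => Complex.exp (-(n * φ l : ℝ) * Complex.I)) := by fun_prop
      exact (this.integrableOn_Icc (a := 0) (b := Real.pi)).mono_set Set.Ioo_subset_Icc_self
    have h7 := integral_re hi
    simp only [RCLike.re_eq_complex_re] at h7
    rw [← h7]
    refine integral_congr_ae (ae_of_all _ fun l => ?_)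
    have : (-(n * φ l : ℝ) * Complex.I : ℂ) = ((-(n * φ l) : ℝ) : ℂ) * Complex.I := by push_cast; ring
    simp only [this, Complex.exp_ofReal_mul_I_re, Real.cos_neg]
  simp_rw [h2]
  have h3 := ((Complex.continuous_re.tendsto 0).comp h1).const_mul 2
  simpa using h3

lemma outer_tendsto :
    Tendsto (fun n : ℕ => ∫ k in (-Real.pi)..Real.pi, ∫ l in (-Real.pi)..Real.pi,
      Real.cos (n * ph k l)) atTop (nhds 0) := by
  have hle : -Real.pi ≤ Real.pi := by linarith [Real.pi_pos]
  have h := intervalIntegral.tendsto_integral_filter_of_dominated_convergence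
    (μ := volume) (a := -Real.pi) (b := Real.pi) (l := atTop)
    (F := fun (n : ℕ) k => ∫ l in (-Real.pi)..Real.pi, Real.cos (n * ph k l))
    (f := fun _ => 0) (fun _ => 1 * |Real.pi - -Real.pi|)
    (Eventually.of_forall fun n => by
      refine Continuous.aestronglyMeasurable ?_
      refine intervalIntegral.continuous_parametric_intervalIntegral_of_continuous' ?_ _ _
      exact Real.continuous_cos.comp (continuous_const.mul continuous_ph))
    (Eventually.of_forall fun n => ae_of_all _ fun k _ => by
      refine intervalIntegral.norm_integral_le_of_norm_le_const fun l _ => ?_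
      exact Real.abs_cos_le_one _)
    (by simp)
    (by
      have h0 : ∀ᵐ x : ℝ, x ≠ Real.pi := by
        simp [ae_iff]
      filter_upwards [h0] with k hk hk2
      rw [Set.uIoc_of_le hle] at hk2
      exact inner_tendsto k ⟨hk2.1, lt_of_le_of_ne hk2.2 hk⟩)
  simpa using h

lemma continuous_Utilde_pow (n : ℕ) (i j : Fin 3) :
    Continuous (fun q : ℝ × ℝ => (Utilde q.1 q.2 ^ n) i j) := by
  have hM : Continuous (fun q : ℝ × ℝ => Mkl q.1 q.2) := by
    unfold Mkl
    refine Continuous.matrix_diagonal ?_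
    refine continuous_pi fun i => ?_
    fin_cases i <;> simp <;> fun_prop
  have hU : Continuous (fun q : ℝ × ℝ => Utilde q.1 q.2) := by
    unfold Utilde
    exact ((hM.matrix_mul continuous_const).matrix_mul hM.matrix_conjTranspose).matrix_mul
      continuous_const
  exact (hU.pow n).matrix_elem i j

/-- The (unnormalized) integral matrix. -/
noncomputable def Eint (n : ℕ) (i j : Fin 3) : ℂ :=
  ∫ k in (-Real.pi)..Real.pi, ∫ l in (-Real.pi)..Real.pi, ((Utilde k l) ^ n) i j

lemma Utilde_periodic (k : ℝ) : Function.Periodic (Utilde k) (2 * Real.pi) := by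
  intro l
  rw [Utilde_eq, Utilde_eq]
  congr 1
  rw [Complex.exp_eq_exp_iff_exists_int]
  exact ⟨-1, by push_cast; ring⟩

lemma Eint_swap12 (n : ℕ) (i j : Fin 3) :
    Eint n (Equiv.swap (1 : Fin 3) 2 i) (Equiv.swap (1 : Fin 3) 2 j) = Eint n i j := by
  simp only [Eint, Utilde_pow_swap12]
  rw [intervalIntegral_intervalIntegral_swap]
  exact (((continuous_Utilde_pow n i j).comp continuous_swap).continuousOn.integrableOn_compact
    (isCompact_uIcc.prod isCompact_uIcc)).mono_set
    (Set.prod_mono Set.uIoc_subset_uIcc Set.uIoc_subset_uIcc)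

lemma Eint_swap01 (n : ℕ) (i j : Fin 3) :
    Eint n (Equiv.swap (0 : Fin 3) 1 i) (Equiv.swap (0 : Fin 3) 1 j) = Eint n i j := by
  simp only [Eint, Utilde_pow_swap01]
  have h1 : ∀ k : ℝ, ∫ l in (-Real.pi)..Real.pi, (Utilde (-k) (l - k) ^ n) i j
      = ∫ l in (-Real.pi)..Real.pi, (Utilde (-k) l ^ n) i j := by
    intro k
    have := periodic_shift (fun l => (Utilde (-k) l ^ n) i j)
      (fun l => by simp only [Utilde_periodic (-k) l]) (-k)
    simpa only [sub_eq_add_neg] using this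
  simp only [h1]
  have := intervalIntegral.integral_comp_neg (a := -Real.pi) (b := Real.pi)
    (fun k => ∫ l in (-Real.pi)..Real.pi, (Utilde k l ^ n) i j)
  rw [neg_neg] at this
  exact this

lemma iint_sum {ι : Type*} (s : Finset ι) (f : ι → ℝ → ℝ → ℂ)
    (hf : ∀ a, Continuous (fun q : ℝ × ℝ => f a q.1 q.2)) :
    ∫ k in (-Real.pi)..Real.pi, ∫ l in (-Real.pi)..Real.pi, ∑ a ∈ s, f a k l
      = ∑ a ∈ s, ∫ k in (-Real.pi)..Real.pi, ∫ l in (-Real.pi)..Real.pi, f a k l := by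
  have h1 : ∀ k : ℝ, ∫ l in (-Real.pi)..Real.pi, ∑ a ∈ s, f a k l
      = ∑ a ∈ s, ∫ l in (-Real.pi)..Real.pi, f a k l := by
    intro k
    refine intervalIntegral.integral_finsetSum fun a _ => Continuous.intervalIntegrable ?_ _ _
    exact (hf a).comp (by fun_prop : Continuous fun l : ℝ => (k, l))
  simp only [h1]
  refine intervalIntegral.integral_finsetSum fun a _ => Continuous.intervalIntegrable ?_ _ _
  exact intervalIntegral.continuous_parametric_intervalIntegral_of_continuous' (hf a) _ _

/-- The oscillating integral. -/
noncomputable def Osc (n : ℕ) : ℝ :=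
  ∫ k in (-Real.pi)..Real.pi, ∫ l in (-Real.pi)..Real.pi, Real.cos (n * ph k l)

lemma continuous_cosph (n : ℕ) : Continuous (fun q : ℝ × ℝ => Real.cos (n * ph q.1 q.2)) :=
  Real.continuous_cos.comp (continuous_const.mul continuous_ph)

lemma Osc_cast (n : ℕ) : ∫ k in (-Real.pi)..Real.pi, ∫ l in (-Real.pi)..Real.pi,
    ((Real.cos (n * ph k l) : ℝ) : ℂ) = (Osc n : ℂ) := by
  simp only [Osc, intervalIntegral.integral_ofReal]

lemma Eint_total (n : ℕ) : ∑ i, ∑ j, Eint n i j = 3 * (Osc n : ℂ) := by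
  have h := iint_sum (Finset.univ : Finset (Fin 3 × Fin 3))
    (fun a k l => (Utilde k l ^ n) a.1 a.2) (fun a => continuous_Utilde_pow n a.1 a.2)
  simp only [Fintype.sum_prod_type, Utilde_total, intervalIntegral.integral_const_mul,
    Osc_cast] at h
  exact h.symm

lemma Eint_trace (n : ℕ) : ∑ i, Eint n i i = (2 * Real.pi) ^ 2 + 2 * (Osc n : ℂ) := by
  have h := iint_sum (Finset.univ : Finset (Fin 3))
    (fun a k l => (Utilde k l ^ n) a a) (fun a => continuous_Utilde_pow n a a)
  simp only [Utilde_trace] at h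
  unfold Eint
  rw [← h]
  have h2 := iint_sum (Finset.univ : Finset (Fin 2))
    (fun a k l => if a = 0 then 1 else 2 * ((Real.cos (n * ph k l) : ℝ) : ℂ)) (by
      intro a
      split_ifs
      · exact continuous_const
      · exact continuous_const.mul (Complex.continuous_ofReal.comp (continuous_cosph n)))
  simp only [Fin.sum_univ_two, if_true, one_ne_zero, if_false,
    intervalIntegral.integral_const_mul, Osc_cast] at h2
  rw [h2]
  simp
  ring

lemma Eint_tendsto (i j : Fin 3) :
    Tendsto (fun n : ℕ => (1 / (2 * Real.pi) ^ 2 : ℂ) * Eint n i j) atTop (nhds (Fmat i j)) := by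
  have hpi : (Real.pi : ℂ) ≠ 0 := by exact_mod_cast Real.pi_ne_zero
  have a0 : Equiv.swap (1 : Fin 3) 2 0 = 0 := by decide
  have a1 : Equiv.swap (1 : Fin 3) 2 1 = 2 := by decide
  have a2 : Equiv.swap (1 : Fin 3) 2 2 = 1 := by decide
  have b0 : Equiv.swap (0 : Fin 3) 1 0 = 1 := by decide
  have b1 : Equiv.swap (0 : Fin 3) 1 1 = 0 := by decide
  have b2 : Equiv.swap (0 : Fin 3) 1 2 = 2 := by decide
  have hE : ∀ n i j, Eint n i j = if i = j then ((2 * Real.pi) ^ 2 + 2 * (Osc n : ℂ)) / 3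
      else (Osc n - (2 * Real.pi) ^ 2 : ℂ) / 6 := by
    intro n
    have t := Eint_trace n
    have u := Eint_total n
    simp only [Fin.sum_univ_three] at t u
    have d1 := Eint_swap12 n 1 1
    have d2 := Eint_swap01 n 0 0
    have o1 := Eint_swap12 n 0 1
    have o2 := Eint_swap12 n 1 0
    have o3 := Eint_swap12 n 1 2
    have o4 := Eint_swap01 n 0 1
    have o5 := Eint_swap01 n 0 2
    have o6 := Eint_swap01 n 2 0
    simp only [a0, a1, a2, b0, b1, b2] at d1 d2 o1 o2 o3 o4 o5 o6
    have D : Eint n 0 0 = ((2 * Real.pi) ^ 2 + 2 * (Osc n : ℂ)) / 3 := by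
      linear_combination t / 3 - d1 / 3 - 2 * d2 / 3
    have O : Eint n 0 1 = (Osc n - (2 * Real.pi) ^ 2 : ℂ) / 6 := by
      have p20 : Eint n 2 0 = Eint n 0 1 := by rw [o2, o4]
      have p12 : Eint n 1 2 = Eint n 0 1 := by rw [o5, o1]
      have p21 : Eint n 2 1 = Eint n 0 1 := by rw [o3, p12]
      rw [o1, o4, p20, p12, p21] at u
      linear_combination u / 6 - t / 6
    have p20 : Eint n 2 0 = Eint n 0 1 := by rw [o2, o4]
    have p12 : Eint n 1 2 = Eint n 0 1 := by rw [o5, o1]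
    have p21 : Eint n 2 1 = Eint n 0 1 := by rw [o3, p12]
    intro i j
    fin_cases i <;> fin_cases j <;> simp [D, O, d1, d2, o1, o4, p20, p12, p21]
  have hO : Tendsto (fun n => (Osc n : ℂ)) atTop (nhds 0) := by
    have := (Complex.continuous_ofReal.tendsto 0).comp outer_tendsto
    rw [Complex.ofReal_zero] at this
    exact this
  by_cases hij : i = j
  · have h := (((hO.const_mul 2).const_add ((2 * Real.pi : ℂ) ^ 2)).div_const 3).const_mul
      (1 / (2 * Real.pi) ^ 2 : ℂ)
    simp only [hE, hij, if_true]
    convert h using 2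
    subst hij
    fin_cases i <;> simp [Fmat] <;> field_simp <;> norm_num
  · have h := ((hO.sub_const ((2 * Real.pi : ℂ) ^ 2)).div_const 6).const_mul
      (1 / (2 * Real.pi) ^ 2 : ℂ)
    simp only [hE, hij, if_false]
    convert h using 2
    fin_cases i <;> fin_cases j <;> simp [Fmat] at hij ⊢ <;> field_simp <;> norm_num

theorem limit_of_integral_of_powers_of_evolution_eq_F :
    (∀ i j : Fin 3,
      Tendsto (fun n : ℕ =>
          (1 / (2 * Real.pi) ^ 2 : ℂ) *
            ∫ k in (-Real.pi)..Real.pi, ∫ l in (-Real.pi)..Real.pi,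
              ((Utilde k l) ^ n) i j)
        atTop (nhds (Fmat i j))) ∧
    ∀ v : Fin 3 → ℂ, ∀ i : Fin 3,
      Tendsto (fun n : ℕ =>
          (1 / (2 * Real.pi) ^ 2 : ℂ) *
            ∫ k in (-Real.pi)..Real.pi, ∫ l in (-Real.pi)..Real.pi,
              (((Utilde k l) ^ n).mulVec v) i)
        atTop (nhds ((Fmat.mulVec v) i)) := by
  refine ⟨Eint_tendsto, fun v i => ?_⟩
  have h : ∀ n : ℕ, ∫ k in (-Real.pi)..Real.pi, ∫ l in (-Real.pi)..Real.pi,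
      (((Utilde k l) ^ n).mulVec v) i = ∑ j, Eint n i j * v j := by
    intro n
    simp only [Matrix.mulVec, dotProduct]
    rw [iint_sum Finset.univ (fun j k l => (Utilde k l ^ n) i j * v j)
      (fun j => (continuous_Utilde_pow n i j).mul continuous_const)]
    simp only [intervalIntegral.integral_mul_const, Eint]
  simp only [h, Finset.mul_sum, ← mul_assoc]
  simp only [Matrix.mulVec, dotProduct]
  exact tendsto_finsetSum _ fun j _ => (Eint_tendsto i j).mul_const (v j)
end

section
/- Let n ≥ 1, let μ be a Haar probability measure on the compact group U(n) of unitary n × n complex matrices, let A be any n × n complex matrix, and let v ∈ ℂⁿ. Then ∫_{U(n)} ‖A·(U·v)‖² dμ(U) = ‖v‖² · Re(tr(Aᴴ·A)) / n. -/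
open Matrix MeasureTheory

theorem aux_perm_mem (n : ℕ) (σ : Equiv.Perm (Fin n)) :
    (σ.permMatrix ℂ) ∈ Matrix.unitaryGroup (Fin n) ℂ := by
  rw [Matrix.mem_unitaryGroup_iff, Matrix.star_eq_conjTranspose, Matrix.conjTranspose_permMatrix,
    ← Matrix.permMatrix_mul]
  simp

theorem aux_diag_mem (n : ℕ) (j : Fin n) :
    (Matrix.diagonal (fun i => if i = j then (-1 : ℂ) else 1)) ∈ Matrix.unitaryGroup (Fin n) ℂ := by
  rw [Matrix.mem_unitaryGroup_iff, Matrix.star_eq_conjTranspose, Matrix.diagonal_conjTranspose,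
    Matrix.diagonal_mul_diagonal, ← Matrix.diagonal_one]
  congr 1
  funext i
  by_cases h : i = j <;> simp [h]

theorem aux_cont (n : ℕ) (v : Fin n → ℂ) (j : Fin n) :
    Continuous (fun U : Matrix.unitaryGroup (Fin n) ℂ =>
      ((U : Matrix (Fin n) (Fin n) ℂ).mulVec v) j) := by
  have : Continuous (fun U : Matrix.unitaryGroup (Fin n) ℂ => (U : Matrix (Fin n) (Fin n) ℂ)) :=
    continuous_subtype_val
  exact (continuous_apply j).comp (this.matrix_mulVec continuous_const)

theorem aux_bound (n : ℕ) (v : Fin n → ℂ) (j : Fin n) (U : Matrix.unitaryGroup (Fin n) ℂ) :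
    ‖((U : Matrix (Fin n) (Fin n) ℂ).mulVec v) j‖ ≤ ∑ i, ‖v i‖ := by
  simp only [Matrix.mulVec, dotProduct]
  refine (norm_sum_le _ _).trans (Finset.sum_le_sum fun i _ => ?_)
  rw [norm_mul]
  exact mul_le_of_le_one_left (norm_nonneg _) (entry_norm_bound_of_unitary U.2 j i)

theorem aux_sum (n : ℕ) (v : Fin n → ℂ) (U : Matrix.unitaryGroup (Fin n) ℂ) :
    ∑ j, ((U : Matrix (Fin n) (Fin n) ℂ).mulVec v) j *
      star (((U : Matrix (Fin n) (Fin n) ℂ).mulVec v) j) = ∑ i, v i * star (v i) := by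
  change ((U : Matrix (Fin n) (Fin n) ℂ) *ᵥ v) ⬝ᵥ star ((U : Matrix (Fin n) (Fin n) ℂ) *ᵥ v)
    = v ⬝ᵥ star v
  have h : (U : Matrix (Fin n) (Fin n) ℂ)ᴴ * (U : Matrix (Fin n) (Fin n) ℂ) = 1 :=
    Matrix.mem_unitaryGroup_iff'.1 U.2
  rw [dotProduct_comm, Matrix.star_mulVec, ← Matrix.dotProduct_mulVec, Matrix.mulVec_mulVec, h,
    Matrix.one_mulVec, dotProduct_comm]

theorem haar_average_of_norm_sq_image (n : ℕ) (hn : 1 ≤ n)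
    [MeasurableSpace (Matrix.unitaryGroup (Fin n) ℂ)]
    [BorelSpace (Matrix.unitaryGroup (Fin n) ℂ)]
    (μ : Measure (Matrix.unitaryGroup (Fin n) ℂ))
    [μ.IsHaarMeasure] [IsProbabilityMeasure μ]
    (A : Matrix (Fin n) (Fin n) ℂ) (v : Fin n → ℂ) :
    ∫ U : Matrix.unitaryGroup (Fin n) ℂ,
        (∑ i, Complex.normSq ((A.mulVec ((U : Matrix (Fin n) (Fin n) ℂ).mulVec v)) i)) ∂μ
      = (∑ i, Complex.normSq (v i)) * ((Aᴴ * A).trace).re / n := by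
  let w : Matrix.unitaryGroup (Fin n) ℂ → Fin n → ℂ :=
    fun U => (U : Matrix (Fin n) (Fin n) ℂ).mulVec v
  have hint : ∀ j k, Integrable (fun U => w U j * star (w U k)) μ := by
    intro j k
    refine Integrable.of_bound (C := (∑ i, ‖v i‖) * (∑ i, ‖v i‖)) ?_ ?_
    · exact ((aux_cont n v j).mul (continuous_star.comp (aux_cont n v k))).measurable.aestronglyMeasurable
    · refine Filter.Eventually.of_forall fun U => ?_
      rw [norm_mul, norm_star]
      exact mul_le_mul (aux_bound n v j U) (aux_bound n v k U) (norm_nonneg _)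
        (Finset.sum_nonneg fun _ _ => norm_nonneg _)
  have hw : ∀ g U : Matrix.unitaryGroup (Fin n) ℂ,
      w (g * U) = (g : Matrix (Fin n) (Fin n) ℂ).mulVec (w U) := by
    intro g U
    simp [w, Matrix.mulVec_mulVec]
  let M : Fin n → Fin n → ℂ := fun j k => ∫ U, w U j * star (w U k) ∂μ
  have hinv : ∀ (g : Matrix.unitaryGroup (Fin n) ℂ) j k, M j k =
      ∫ U, w (g * U) j * star (w (g * U) k) ∂μ := fun g j k =>
    (integral_mul_left_eq_self (μ := μ) (fun U => w U j * star (w U k)) g).symm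
  have hoff : ∀ j k, j ≠ k → M j k = 0 := by
    intro j k hjk
    have h := hinv ⟨_, aux_diag_mem n j⟩ j k
    simp only [hw, Matrix.mulVec_diagonal, if_true, if_neg hjk.symm, one_mul, neg_mul,
      integral_neg] at h
    exact self_eq_neg.1 h
  have hdiag : ∀ j k, M j j = M k k := by
    intro j k
    have h := hinv ⟨_, aux_perm_mem n (Equiv.swap j k)⟩ j j
    simpa only [hw, Matrix.permMatrix_mulVec, Function.comp, Equiv.swap_apply_left] using h
  have hS : ∑ j, M j j = ∑ i, v i * star (v i) := by
    simp only [M]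
    rw [← integral_finsetSum _ (fun j _ => hint j j)]
    simp only [w, aux_sum]
    simp
  have hMj : ∀ j, M j j = (∑ i, v i * star (v i)) / n := by
    intro j
    have hn' : (n : ℂ) ≠ 0 := by exact_mod_cast (by omega : n ≠ 0)
    rw [← hS, eq_div_iff hn', Finset.sum_congr rfl (fun k _ => hdiag k j)]
    simp [mul_comm]
  have hns : ∀ z : ℂ, ((Complex.normSq z : ℝ) : ℂ) = z * star z := fun z =>
    (Complex.mul_conj z).symm
  have htr : (((Aᴴ * A).trace.re : ℝ) : ℂ) = ∑ i, ∑ j, A i j * star (A i j) := by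
    have h1 : (Aᴴ * A).trace = ((∑ i, ∑ j, Complex.normSq (A i j) : ℝ) : ℂ) := by
      push_cast
      simp only [hns]
      rw [Finset.sum_comm]
      simp [Matrix.trace, Matrix.mul_apply, mul_comm]
    rw [h1, Complex.ofReal_re]
    push_cast
    simp only [hns]
  apply Complex.ofReal_injective
  rw [← integral_complex_ofReal]
  push_cast
  rw [htr]
  simp only [hns]
  have hexp : ∀ U : Matrix.unitaryGroup (Fin n) ℂ,
      (∑ i, (A.mulVec (w U)) i * star ((A.mulVec (w U)) i)) =
      ∑ i, ∑ j, ∑ k, (A i j * star (A i k)) * (w U j * star (w U k)) := by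
    intro U
    refine Finset.sum_congr rfl fun i _ => ?_
    simp only [Matrix.mulVec, dotProduct, star_sum, Finset.sum_mul_sum, star_mul']
    refine Finset.sum_congr rfl fun j _ => Finset.sum_congr rfl fun k _ => by ring
  change ∫ U, (∑ i, (A.mulVec (w U)) i * star ((A.mulVec (w U)) i)) ∂μ = _
  simp only [hexp]
  have hint' : ∀ i j k, Integrable
      (fun U => (A i j * star (A i k)) * (w U j * star (w U k))) μ :=
    fun i j k => (hint j k).const_mul _
  rw [integral_finsetSum _ (fun i _ => integrable_finsetSum _ fun j _ =>
    integrable_finsetSum _ fun k _ => hint' i j k), mul_div_right_comm, Finset.mul_sum]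
  refine Finset.sum_congr rfl fun i _ => ?_
  rw [integral_finsetSum _ (fun j _ => integrable_finsetSum _ fun k _ => hint' i j k),
    Finset.mul_sum]
  refine Finset.sum_congr rfl fun j _ => ?_
  rw [integral_finsetSum _ (fun k _ => hint' i j k), Finset.sum_eq_single j]
  · rw [integral_const_mul, ← hMj j, mul_comm]
  · intro k _ hk
    rw [integral_const_mul]
    change _ * M j k = 0
    rw [hoff j k hk.symm, mul_zero]
  · simp
end

section
/- Let F = (1/6)·[[2, −1, −1], [−1, 2, −1], [−1, −1, 2]], regarded as a complex matrix, and let μ be a Haar probability measure on the compact group U(3) of unitary 3 × 3 complex matrices. Then for every unit vector e ∈ ℂ³, ∫_{U(3)} ‖F·(U·e)‖² dμ(U) = 1/6. That is, the average localization probability of the Grover walk on the honeycomb network over uniformly random initial coin states equals 1/6. -/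
open Matrix MeasureTheory

/-- Diagonal sign matrix flipping coordinate `k` (as a unitary). -/
noncomputable def signU (k : Fin 3) : Matrix.unitaryGroup (Fin 3) ℂ :=
  ⟨Matrix.diagonal (fun i => if i = k then -1 else 1), by
    rw [Matrix.mem_unitaryGroup_iff, Matrix.star_eq_conjTranspose, Matrix.diagonal_conjTranspose,
      Matrix.diagonal_mul_diagonal, ← Matrix.diagonal_one]
    congr 1
    funext i
    by_cases h : i = k <;> simp [h]⟩

/-- The localization probability of a coin vector. -/
noncomputable def locP (v : Fin 3 → ℂ) : ℝ := ∑ i, Complex.normSq (Fmat.mulVec v i)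

lemma locP_nonneg (v : Fin 3 → ℂ) : 0 ≤ locP v :=
  Finset.sum_nonneg fun _ _ => Complex.normSq_nonneg _

lemma locP_sum (v : Fin 3 → ℂ) :
    locP v + ∑ k, locP ((signU k : Matrix (Fin 3) (Fin 3) ℂ).mulVec v)
      = 2 / 3 * ∑ i, Complex.normSq (v i) := by
  simp [locP, signU, Fmat, Matrix.mulVec, dotProduct, Matrix.diagonal_apply, Fin.sum_univ_three,
    Complex.normSq_apply]
  ring

lemma unitary_normSq (U : Matrix.unitaryGroup (Fin 3) ℂ) (e : Fin 3 → ℂ) :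
    ∑ i, Complex.normSq ((U : Matrix (Fin 3) (Fin 3) ℂ).mulVec e i)
      = ∑ i, Complex.normSq (e i) := by
  have key : ∀ v : Fin 3 → ℂ, ((∑ i, Complex.normSq (v i) : ℝ) : ℂ) = star v ⬝ᵥ v := by
    intro v
    simp [dotProduct, Complex.normSq_eq_conj_mul_self]
  have hU : (U : Matrix (Fin 3) (Fin 3) ℂ)ᴴ * (U : Matrix (Fin 3) (Fin 3) ℂ) = 1 :=
    Matrix.mem_unitaryGroup_iff'.1 U.2
  apply Complex.ofReal_injective
  rw [key, key, Matrix.star_mulVec, ← Matrix.dotProduct_mulVec, Matrix.mulVec_mulVec, hU,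
    Matrix.one_mulVec]

theorem average_localization_probability_eq_one_sixth
    [MeasurableSpace (Matrix.unitaryGroup (Fin 3) ℂ)]
    [BorelSpace (Matrix.unitaryGroup (Fin 3) ℂ)]
    (μ : Measure (Matrix.unitaryGroup (Fin 3) ℂ))
    [μ.IsHaarMeasure] [IsProbabilityMeasure μ]
    (e : Fin 3 → ℂ) (he : ∑ i, Complex.normSq (e i) = 1) :
    ∫ U : Matrix.unitaryGroup (Fin 3) ℂ,
        (∑ i, Complex.normSq ((Fmat.mulVec ((U : Matrix (Fin 3) (Fin 3) ℂ).mulVec e)) i)) ∂μ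
      = 1 / 6 := by
  let f : Matrix.unitaryGroup (Fin 3) ℂ → ℝ :=
    fun U => locP ((U : Matrix (Fin 3) (Fin 3) ℂ).mulVec e)
  change ∫ U, f U ∂μ = 1 / 6
  have hsum : ∀ U, f U + ∑ k, f (signU k * U) = 2 / 3 := by
    intro U
    have h := locP_sum ((U : Matrix (Fin 3) (Fin 3) ℂ).mulVec e)
    rw [unitary_normSq, he, mul_one] at h
    simpa [f, Matrix.mulVec_mulVec] using h
  have hpos : ∀ U, 0 ≤ f U := fun U => locP_nonneg _
  have hcont : Continuous f := by
    have h0 : Continuous fun U : Matrix.unitaryGroup (Fin 3) ℂ =>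
      (U : Matrix (Fin 3) (Fin 3) ℂ) := continuous_subtype_val
    refine continuous_finsetSum _ fun i _ => Complex.continuous_normSq.comp ?_
    exact (continuous_apply i).comp
      (continuous_const.matrix_mulVec (h0.matrix_mulVec continuous_const))
  have hbd : ∀ U, f U ≤ 2 / 3 := by
    intro U
    have h1 : 0 ≤ ∑ k, f (signU k * U) := Finset.sum_nonneg fun k _ => hpos _
    linarith [hsum U]
  have hint : Integrable f μ :=
    Integrable.of_bound hcont.measurable.aestronglyMeasurable (2 / 3)
      (Filter.Eventually.of_forall fun U => by
        rw [Real.norm_of_nonneg (hpos U)]; exact hbd U)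
  have hint' : ∀ k, Integrable (fun U => f (signU k * U)) μ := fun k => hint.comp_mul_left _
  have hI : ∫ U, (f U + ∑ k, f (signU k * U)) ∂μ = 2 / 3 := by
    simp [hsum]
  rw [integral_add hint (integrable_finset_sum _ fun k _ => hint' k),
    integral_finset_sum _ fun k _ => hint' k] at hI
  simp only [integral_mul_left_eq_self f, Finset.sum_const, Finset.card_univ, Fintype.card_fin,
    nsmul_eq_mul] at hI
  push_cast at hI
  linarith
end

section
/- Let G₄ = (1/2)·[[−1,1,1,1],[1,−1,1,1],[1,1,−1,1],[1,1,1,−1]] be the 4D Grover coin, let C₄ be the 4 × 4 matrix whose fourth row is (1/2)·(1,1,1,−1) and whose other entries are all zero, and for real k, l let M′(k, l) = diag(1, e^{−ik}, e^{−il}, 0) and let Ũ′(k, l) be the 8 × 8 block matrix [[C₄, M′(k,l)·G₄], [M′(k,l)ᴴ·G₄, C₄]]. Define the vectors in ℂ⁸: φ′₁ = (e^{il}−e^{ik}, 1−e^{il}, e^{ik}−1, 0, e^{ik}−e^{il}, e^{ik}(e^{il}−1), −e^{il}(e^{ik}−1), 0), φ′₂ = (−1,0,0,1,−1,0,0,1),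 φ′₃ = (0, e^{−ik}, 0, −e^{−ik}, 0, 1, 0, −1), φ′₄ = (0, 0, e^{−il}, −e^{−il}, 0, 0, 1, −1). Then for all real k, l: Ũ′(k,l)·φ′₁ = φ′₁, and Ũ′(k,l)·φ′ⱼ = −φ′ⱼ for j = 2, 3, 4; moreover φ′₂, φ′₃, φ′₄ are linearly independent. Hence 1 is an eigenvalue of Ũ′(k, l) (whenever φ′₁ ≠ 0) and −1 is an eigenvalue of multiplicity at least 3. -/
open Matrix

/-- The 4D Grover coin. -/
noncomputable def GroverCoin4 : Matrix (Fin 4) (Fin 4) ℂ :=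
  (1/2 : ℂ) • !![-1, 1, 1, 1; 1, -1, 1, 1; 1, 1, -1, 1; 1, 1, 1, -1]

/-- The matrix keeping only the fourth row of the 4D Grover coin. -/
noncomputable def C4 : Matrix (Fin 4) (Fin 4) ℂ :=
  !![0, 0, 0, 0; 0, 0, 0, 0; 0, 0, 0, 0; 1/2, 1/2, 1/2, -1/2]

/-- `M'(k, l) = diag(1, e^{-ik}, e^{-il}, 0)`. -/
noncomputable def Mkl' (k l : ℝ) : Matrix (Fin 4) (Fin 4) ℂ :=
  Matrix.diagonal ![1, Complex.exp (-Complex.I * k), Complex.exp (-Complex.I * l), 0]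

/-- The 8 × 8 Fourier-space evolution operator of the four-state Grover walk on the
honeycomb network. -/
noncomputable def Utilde4 (k l : ℝ) : Matrix (Fin 4 ⊕ Fin 4) (Fin 4 ⊕ Fin 4) ℂ :=
  Matrix.fromBlocks C4 (Mkl' k l * GroverCoin4) ((Mkl' k l)ᴴ * GroverCoin4) C4

/-- The eigenvector of `Utilde4` with eigenvalue `1`. -/
noncomputable def phi1' (k l : ℝ) : Fin 4 ⊕ Fin 4 → ℂ :=
  Sum.elim
    ![Complex.exp (Complex.I * l) - Complex.exp (Complex.I * k),
      1 - Complex.exp (Complex.I * l),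
      Complex.exp (Complex.I * k) - 1, 0]
    ![Complex.exp (Complex.I * k) - Complex.exp (Complex.I * l),
      Complex.exp (Complex.I * k) * (Complex.exp (Complex.I * l) - 1),
      -Complex.exp (Complex.I * l) * (Complex.exp (Complex.I * k) - 1), 0]

/-- The first eigenvector of `Utilde4` with eigenvalue `-1`. -/
noncomputable def phi2' (_k _l : ℝ) : Fin 4 ⊕ Fin 4 → ℂ :=
  Sum.elim ![-1, 0, 0, 1] ![-1, 0, 0, 1]

/-- The second eigenvector of `Utilde4` with eigenvalue `-1`. -/
noncomputable def phi3' (k _l : ℝ) : Fin 4 ⊕ Fin 4 → ℂ :=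
  Sum.elim ![0, Complex.exp (-Complex.I * k), 0, -Complex.exp (-Complex.I * k)]
    ![0, 1, 0, -1]

/-- The third eigenvector of `Utilde4` with eigenvalue `-1`. -/
noncomputable def phi4' (_k l : ℝ) : Fin 4 ⊕ Fin 4 → ℂ :=
  Sum.elim ![0, 0, Complex.exp (-Complex.I * l), -Complex.exp (-Complex.I * l)]
    ![0, 0, 1, -1]


lemma exp_conj_aux (k : ℝ) :
    star (Complex.exp (-Complex.I * k)) = Complex.exp (Complex.I * k) := by
  rw [Complex.star_def, ← Complex.exp_conj]
  simp

lemma exp_mul_aux (k : ℝ) :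
    Complex.exp (Complex.I * k) * Complex.exp (-Complex.I * k) = 1 := by
  rw [← Complex.exp_add]
  simp

lemma Utilde4_mulVec (k l : ℝ) (a b : Fin 4 → ℂ) :
    (Utilde4 k l).mulVec (Sum.elim a b) = Sum.elim
      ![(b 0 + b 1 + b 2 + b 3) / 2 - b 0,
        Complex.exp (-Complex.I * k) * ((b 0 + b 1 + b 2 + b 3) / 2 - b 1),
        Complex.exp (-Complex.I * l) * ((b 0 + b 1 + b 2 + b 3) / 2 - b 2),
        (a 0 + a 1 + a 2 + a 3) / 2 - a 3]
      ![(a 0 + a 1 + a 2 + a 3) / 2 - a 0,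
        Complex.exp (Complex.I * k) * ((a 0 + a 1 + a 2 + a 3) / 2 - a 1),
        Complex.exp (Complex.I * l) * ((a 0 + a 1 + a 2 + a 3) / 2 - a 2),
        (b 0 + b 1 + b 2 + b 3) / 2 - b 3] := by
  have hk := exp_conj_aux k
  have hl := exp_conj_aux l
  unfold Utilde4 Mkl'
  rw [Matrix.fromBlocks_mulVec, Matrix.diagonal_conjTranspose]
  simp only [← Matrix.mulVec_mulVec]
  generalize Complex.exp (-Complex.I * k) = x at *
  generalize Complex.exp (-Complex.I * l) = y at *
  rw [← hk, ← hl]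
  ext i
  rcases i with i | i <;> fin_cases i <;>
    simp only [Sum.elim_inl, Sum.elim_inr, Pi.add_apply, Matrix.mulVec_diagonal,
      Function.comp_def] <;>
    simp [C4, GroverCoin4, Matrix.mulVec, dotProduct, Fin.sum_univ_four, -mul_eq_mul_left_iff] <;> ring

theorem four_state_grover_walk_eigenvectors (k l : ℝ) :
    (Utilde4 k l).mulVec (phi1' k l) = phi1' k l ∧
    (Utilde4 k l).mulVec (phi2' k l) = -phi2' k l ∧
    (Utilde4 k l).mulVec (phi3' k l) = -phi3' k l ∧
    (Utilde4 k l).mulVec (phi4' k l) = -phi4' k l ∧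
    LinearIndependent ℂ ![phi2' k l, phi3' k l, phi4' k l] := by
  have hk := exp_mul_aux k
  have hl := exp_mul_aux l
  unfold phi1' phi2' phi3' phi4'
  simp only [Utilde4_mulVec]
  generalize Complex.exp (-Complex.I * k) = x at *
  generalize Complex.exp (-Complex.I * l) = y at *
  generalize Complex.exp (Complex.I * k) = u at *
  generalize Complex.exp (Complex.I * l) = v at *
  refine ⟨?_, ?_, ?_, ?_, ?_⟩
  iterate 4
    ext i
    rcases i with i | i <;> fin_cases i <;> simp <;> grind
  rw [Fintype.linearIndependent_iff]
  intro g hg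
  have h0 := congrFun hg (Sum.inr 0)
  have h1 := congrFun hg (Sum.inr 1)
  have h2 := congrFun hg (Sum.inr 2)
  simp [Fin.sum_univ_three] at h0 h1 h2
  intro i
  fin_cases i <;> simp [h0, h1, h2]
end

section
/- Let φ′₁(k, l) = (e^{il}−e^{ik}, 1−e^{il}, e^{ik}−1, 0, e^{ik}−e^{il}, e^{ik}(e^{il}−1), −e^{il}(e^{ik}−1), 0) ∈ ℂ⁸. Then φ′₁(k, l) ≠ 0 for almost every (k, l) ∈ [−π, π]², and the upper-left 4 × 4 block of the 8 × 8 matrix (1/(2π)²) · ∫∫_{[−π,π]²} (φ′₁(k, l) · φ′₁(k, l)ᴴ) / ‖φ′₁(k, l)‖² dk dl equals F₊ = (1/12)·[[2, −1, −1, 0], [−1, 2, −1, 0], [−1, −1, 2, 0], [0, 0, 0, 0]]. -/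
open Matrix MeasureTheory
/-- The matrix `F₊` appearing in the limit of the four-state Grover walk. -/
noncomputable def Fplus : Matrix (Fin 4) (Fin 4) ℂ :=
  (1/12 : ℂ) • !![2, -1, -1, 0; -1, 2, -1, 0; -1, -1, 2, 0; 0, 0, 0, 0]


noncomputable def nrmS (k l : ℝ) : ℝ := ∑ m, Complex.normSq (phi1' k l m)

noncomputable def gS (i j : Fin 4) (k l : ℝ) : ℂ :=
  (phi1' k l (Sum.inl i) * (starRingEnd ℂ) (phi1' k l (Sum.inl j))) / ((nrmS k l : ℝ) : ℂ)

noncomputable def nuS : Measure ℝ := volume.restrict (Set.Ioc (-Real.pi) Real.pi)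

instance nuS_fin : IsFiniteMeasure nuS := by
  unfold nuS
  infer_instance

lemma conj_expS (k : ℝ) : (starRingEnd ℂ) (Complex.exp (Complex.I * k))
    = Complex.exp (-(Complex.I * k)) := by
  rw [← Complex.exp_conj]; simp

lemma conj_expS' (k : ℝ) : (starRingEnd ℂ) (Complex.exp (-(Complex.I * k)))
    = Complex.exp (Complex.I * k) := by
  rw [← Complex.exp_conj]; simp

lemma exp_mulS (k : ℝ) : Complex.exp (Complex.I * k) * Complex.exp (-(Complex.I * k)) = 1 := by
  rw [← Complex.exp_add]; simp

lemma nrmS_eq (k l : ℝ) : ((nrmS k l : ℝ) : ℂ) =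
    2 * (6 - Complex.exp (Complex.I * l) * Complex.exp (-(Complex.I * k))
      - Complex.exp (Complex.I * k) * Complex.exp (-(Complex.I * l))
      - Complex.exp (Complex.I * l) - Complex.exp (-(Complex.I * l))
      - Complex.exp (Complex.I * k) - Complex.exp (-(Complex.I * k))) := by
  have hk := exp_mulS k
  have hl := exp_mulS l
  unfold nrmS
  push_cast
  simp only [Complex.normSq_eq_conj_mul_self, Fintype.sum_sum_type, Fin.sum_univ_four, phi1',
    Sum.elim_inl, Sum.elim_inr]
  simp only [Matrix.cons_val, map_sub, map_mul, map_neg, map_one, map_zero, conj_expS]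
  generalize Complex.exp (Complex.I * k) = x at *
  generalize Complex.exp (Complex.I * l) = y at *
  generalize Complex.exp (-(Complex.I * k)) = x' at *
  generalize Complex.exp (-(Complex.I * l)) = y' at *
  grind

lemma cont_phiS (m : Fin 4 ⊕ Fin 4) : Continuous (fun p : ℝ × ℝ => phi1' p.1 p.2 m) := by
  rcases m with m | m <;> fin_cases m <;> simp [phi1'] <;> fun_prop

lemma meas_gS (i j : Fin 4) : Measurable (fun p : ℝ × ℝ => gS i j p.1 p.2) := by
  unfold gS nrmS
  apply Measurable.div
  · exact ((cont_phiS _).mul (Complex.continuous_conj.comp (cont_phiS _))).measurable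
  · refine Continuous.measurable ?_
    refine Complex.continuous_ofReal.comp ?_
    exact continuous_finsetSum _ fun m _ => Complex.continuous_normSq.comp (cont_phiS m)

lemma bound_gS (i j : Fin 4) (k l : ℝ) : ‖gS i j k l‖ ≤ 1 := by
  have h : ∀ m, ‖phi1' k l m‖ ^ 2 ≤ nrmS k l := fun m => by
    rw [← Complex.normSq_eq_norm_sq]
    exact Finset.single_le_sum (f := fun m => Complex.normSq (phi1' k l m))
      (fun _ _ => Complex.normSq_nonneg _) (Finset.mem_univ m)
  have h0 : 0 ≤ nrmS k l := (sq_nonneg _).trans (h (Sum.inl i))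
  unfold gS
  rw [norm_div, norm_mul, RCLike.norm_conj, Complex.norm_real, Real.norm_of_nonneg h0]
  refine div_le_one_of_le₀ ?_ h0
  nlinarith [h (Sum.inl i), h (Sum.inl j),
    sq_nonneg (‖phi1' k l (Sum.inl i)‖ - ‖phi1' k l (Sum.inl j)‖)]

lemma int_gS (i j : Fin 4) : Integrable (fun p : ℝ × ℝ => gS i j p.1 p.2) (nuS.prod nuS) :=
  Integrable.of_bound (meas_gS i j).aestronglyMeasurable 1
    (Filter.Eventually.of_forall fun p => bound_gS i j p.1 p.2)

noncomputable def IS (i j : Fin 4) : ℂ := ∫ p, gS i j p.1 p.2 ∂(nuS.prod nuS)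

lemma IS_eq (i j : Fin 4) :
    ∫ k in (-Real.pi)..Real.pi, ∫ l in (-Real.pi)..Real.pi, gS i j k l = IS i j := by
  have hpi : -Real.pi ≤ Real.pi := by linarith [Real.pi_pos]
  unfold IS
  rw [integral_prod _ (int_gS i j)]
  simp only [intervalIntegral.integral_of_le hpi, nuS]

lemma ae_neS (ν : Measure ℝ) [SFinite ν] [NullSingletonClass ν] (ν' : Measure ℝ) [SFinite ν'] :
    ∀ᵐ p : ℝ × ℝ ∂(ν.prod ν'), phi1' p.1 p.2 ≠ 0 := by
  have hc : (Set.range (fun n : ℤ => (n : ℝ) * (2 * Real.pi))).Countable :=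
    Set.countable_range _
  have h := Measure.quasiMeasurePreserving_fst (μ := ν) (ν := ν') |>.ae (hc.ae_notMem ν)
  filter_upwards [h] with p hp h0
  apply hp
  have h2 := congrFun h0 (Sum.inl 2)
  simp only [phi1', Sum.elim_inl, Matrix.cons_val, Pi.zero_apply] at h2
  obtain ⟨n, hn⟩ := Complex.exp_eq_one_iff.1 (sub_eq_zero.1 h2)
  refine ⟨n, ?_⟩
  have := congrArg Complex.im hn
  simpa using this.symm

lemma nrm_neS {k l : ℝ} (h : phi1' k l ≠ 0) : ((nrmS k l : ℝ) : ℂ) ≠ 0 := by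
  intro h0
  apply h
  have h1 : nrmS k l = 0 := by exact_mod_cast h0
  unfold nrmS at h1
  rw [Finset.sum_eq_zero_iff_of_nonneg (fun _ _ => Complex.normSq_nonneg _)] at h1
  funext m
  exact Complex.normSq_eq_zero.1 (h1 m (Finset.mem_univ _))

lemma swapS (i j i' j' : Fin 4) (h : ∀ k l, gS i j l k = gS i' j' k l) : IS i j = IS i' j' := by
  unfold IS
  rw [← integral_prod_swap]
  simp only [Prod.fst_swap, Prod.snd_swap, h]

lemma diagS : IS 0 0 = IS 1 1 := by
  rw [← IS_eq, ← IS_eq]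
  congr 1
  funext k
  have h1 : ∀ l, gS 1 1 k l = gS 0 0 k (k - l) := by
    intro l
    have hk := exp_mulS k
    have hl := exp_mulS l
    have e1 : Complex.exp (Complex.I * ((k - l : ℝ) : ℂ))
        = Complex.exp (Complex.I * k) * Complex.exp (-(Complex.I * l)) := by
      rw [← Complex.exp_add]; push_cast; ring_nf
    have e2 : Complex.exp (-(Complex.I * ((k - l : ℝ) : ℂ)))
        = Complex.exp (-(Complex.I * k)) * Complex.exp (Complex.I * l) := by
      rw [← Complex.exp_add]; push_cast; ring_nf
    unfold gS
    rw [nrmS_eq, nrmS_eq]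
    simp only [phi1', Sum.elim_inl, Matrix.cons_val, map_sub, map_one, conj_expS, e1, e2, map_mul, conj_expS']
    generalize Complex.exp (Complex.I * k) = x at *
    generalize Complex.exp (Complex.I * l) = y at *
    generalize Complex.exp (-(Complex.I * k)) = x' at *
    generalize Complex.exp (-(Complex.I * l)) = y' at *
    congr 1
    · grind
    · grind
  have hp : Function.Periodic (fun l => gS 0 0 k l) (2 * Real.pi) := by
    intro l
    have e : Complex.exp (Complex.I * ((l + 2 * Real.pi : ℝ) : ℂ))
        = Complex.exp (Complex.I * l) := by
      rw [← Complex.exp_periodic (Complex.I * l)]; push_cast; ring_nf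
    simp only [gS, nrmS, phi1', e]
  simp only [h1]
  rw [intervalIntegral.integral_comp_sub_left (fun l => gS 0 0 k l)]
  have := hp.intervalIntegral_add_eq (-Real.pi) (k - Real.pi)
  convert this using 2 <;> ring

lemma swap1S : IS 0 1 = IS 0 2 := by
  refine swapS _ _ _ _ fun k l => ?_
  unfold gS
  rw [nrmS_eq, nrmS_eq]
  simp only [phi1', Sum.elim_inl, Matrix.cons_val, map_sub, map_one, conj_expS]
  congr 1 <;> ring

lemma swap2S : IS 1 0 = IS 2 0 := by
  refine swapS _ _ _ _ fun k l => ?_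
  unfold gS
  rw [nrmS_eq, nrmS_eq]
  simp only [phi1', Sum.elim_inl, Matrix.cons_val, map_sub, map_one, conj_expS]
  congr 1 <;> ring

lemma swap3S : IS 1 1 = IS 2 2 := by
  refine swapS _ _ _ _ fun k l => ?_
  unfold gS
  rw [nrmS_eq, nrmS_eq]
  simp only [phi1', Sum.elim_inl, Matrix.cons_val, map_sub, map_one, conj_expS]
  congr 1 <;> ring

lemma add3S (i j i' j' i2 j2 : Fin 4) :
    (∫ p, gS i j p.1 p.2 ∂(nuS.prod nuS)) + (∫ p, gS i' j' p.1 p.2 ∂(nuS.prod nuS))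
      + (∫ p, gS i2 j2 p.1 p.2 ∂(nuS.prod nuS))
    = ∫ p, (gS i j p.1 p.2 + gS i' j' p.1 p.2 + gS i2 j2 p.1 p.2) ∂(nuS.prod nuS) := by
  rw [integral_add (f := fun p : ℝ × ℝ => gS i j p.1 p.2 + gS i' j' p.1 p.2)
    ((int_gS _ _).add (int_gS _ _)) (int_gS _ _),
    integral_add (int_gS _ _) (int_gS _ _)]

lemma rowS (i : Fin 4) : IS i 0 + IS i 1 + IS i 2 = 0 := by
  unfold IS
  rw [add3S]
  rw [← integral_zero (ℝ × ℝ) ℂ (μ := nuS.prod nuS)]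
  congr 1
  funext p
  unfold gS
  simp only [phi1', Sum.elim_inl, Matrix.cons_val, map_sub, map_one, conj_expS]
  ring

lemma colS : IS 0 0 + IS 1 0 + IS 2 0 = 0 := by
  unfold IS
  rw [add3S]
  rw [← integral_zero (ℝ × ℝ) ℂ (μ := nuS.prod nuS)]
  congr 1
  funext p
  unfold gS
  simp only [phi1', Sum.elim_inl, Matrix.cons_val, map_sub, map_one, conj_expS]
  ring

lemma traceS : IS 0 0 + IS 1 1 + IS 2 2 = (2 * Real.pi) ^ 2 / 2 := by
  have hpi := Real.pi_pos
  have hc : ∫ _p : ℝ × ℝ, (1 / 2 : ℂ) ∂(nuS.prod nuS) = (2 * Real.pi) ^ 2 / 2 := by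
    have : nuS.real Set.univ = 2 * Real.pi := by
      simp [nuS, Measure.real]
      rw [ENNReal.toReal_ofReal] <;> linarith
    rw [integral_const, ← Set.univ_prod_univ, measureReal_prod_prod, this, Complex.real_smul]
    push_cast; ring
  rw [← hc]
  unfold IS
  rw [add3S]
  haveI : NullSingletonClass nuS := by unfold nuS; infer_instance
  apply integral_congr_ae
  filter_upwards [ae_neS nuS nuS] with p hp
  have hn := nrm_neS hp
  simp only [gS]
  rw [← add_div, ← add_div, div_eq_div_iff hn two_ne_zero, nrmS_eq]
  simp only [phi1', Sum.elim_inl, Matrix.cons_val, map_sub, map_one, conj_expS]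
  have hk := exp_mulS p.1
  have hl := exp_mulS p.2
  linear_combination 4 * hk + 4 * hl

lemma zeroS (i : Fin 4) : IS i 3 = 0 ∧ IS 3 i = 0 := by
  constructor <;> simp [IS, gS, phi1']

theorem integral_normalized_projector_four_state_upper_left_block :
    (∀ᵐ p : ℝ × ℝ ∂(volume.restrict (Set.Icc (-Real.pi) Real.pi ×ˢ
        Set.Icc (-Real.pi) Real.pi)), phi1' p.1 p.2 ≠ 0) ∧
    ∀ i j : Fin 4,
      (1 / (2 * Real.pi) ^ 2 : ℂ) *
        ∫ k in (-Real.pi)..Real.pi, ∫ l in (-Real.pi)..Real.pi,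
          (phi1' k l (Sum.inl i) * (starRingEnd ℂ) (phi1' k l (Sum.inl j))) /
            ((∑ m, Complex.normSq (phi1' k l m) : ℝ) : ℂ)
      = Fplus i j := by

  constructor
  · apply ae_restrict_of_ae
    exact ae_neS volume volume
  · intro i j
    have key : (∫ k in (-Real.pi)..Real.pi, ∫ l in (-Real.pi)..Real.pi,
          (phi1' k l (Sum.inl i) * (starRingEnd ℂ) (phi1' k l (Sum.inl j))) /
            ((∑ m, Complex.normSq (phi1' k l m) : ℝ) : ℂ)) = IS i j := IS_eq i j
    rw [key]
    have hpi : (Real.pi : ℂ) ≠ 0 := by exact_mod_cast Real.pi_ne_zero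
    have hF : IS i j = (2 * Real.pi) ^ 2 * Fplus i j := by
      have t := traceS
      have d1 := diagS
      have d2 := swap3S
      have s1 := swap1S
      have s2 := swap2S
      have r0 := rowS 0
      have r1 := rowS 1
      have r2 := rowS 2
      have c0 := colS
      have z := zeroS
      generalize ((2 * Real.pi) ^ 2 : ℂ) = T at *
      fin_cases i <;> fin_cases j <;> simp [Fplus, z] <;> grind
    rw [hF]
    field_simp
end

section
/- Let F′ = (1/√6)·[[1, √6−2, 2√6−5], [√6−2, √6−2, √6−2], [2√6−5, √6−2, 1]], a real symmetric 3 × 3 matrix. Then: (i) F′·u = (3−√6)·u for u = (1/√3)·(1,1,1); (ii) F′·w = 0 for w = (1/√6)·(1,−2,1); (iii) F′·z = (√6−2)·z for z = (1/√2)·(−1,0,1); and (iv) for every v ∈ ℂ³ with ‖v‖ = 1, ‖F′·v‖ ≤ 3−√6, with equality if and only if v is a scalar multiple of u. In particular the maximal localization probability of the 1D three-state Grover walk is (3−√6)² and is attained at the initial coin state (1/√3)·(1,1,1), while the initial coin state (1/√6)·(1,−2,1) gives localization probability 0. -/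
open Matrix

/-- The transformation matrix `F'` of the three-state Grover walk on a line,
regarded as a complex matrix. -/
noncomputable def Fline : Matrix (Fin 3) (Fin 3) ℂ :=
  ((Real.sqrt 6 : ℂ))⁻¹ •
    !![1, (Real.sqrt 6 : ℂ) - 2, 2 * (Real.sqrt 6 : ℂ) - 5;
       (Real.sqrt 6 : ℂ) - 2, (Real.sqrt 6 : ℂ) - 2, (Real.sqrt 6 : ℂ) - 2;
       2 * (Real.sqrt 6 : ℂ) - 5, (Real.sqrt 6 : ℂ) - 2, 1]

/-- `u = (1/√3)·(1,1,1)`. -/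
noncomputable def uVec : Fin 3 → ℂ := ((Real.sqrt 3 : ℂ))⁻¹ • ![1, 1, 1]

/-- `w = (1/√6)·(1,−2,1)`. -/
noncomputable def wVec : Fin 3 → ℂ := ((Real.sqrt 6 : ℂ))⁻¹ • ![1, -2, 1]

/-- `z = (1/√2)·(−1,0,1)`. -/
noncomputable def zVec : Fin 3 → ℂ := ((Real.sqrt 2 : ℂ))⁻¹ • ![-1, 0, 1]

lemma sqrt6_sq : Real.sqrt 6 * Real.sqrt 6 = 6 := Real.mul_self_sqrt (by norm_num)

lemma sqrt6_sqC : (Real.sqrt 6 : ℂ) * (Real.sqrt 6 : ℂ) = 6 := by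
  exact_mod_cast congrArg (fun x : ℝ => (x : ℂ)) sqrt6_sq

lemma sqrt6_lt : Real.sqrt 6 < 5 / 2 := by
  rw [Real.sqrt_lt' (by norm_num)]; norm_num

lemma sqrt6_inv : ((Real.sqrt 6 : ℂ))⁻¹ = (Real.sqrt 6 : ℂ) / 6 := by
  have h := sqrt6_sqC
  have h0 : (Real.sqrt 6 : ℂ) ≠ 0 := by
    intro h0
    rw [h0] at h
    norm_num at h
  field_simp
  linear_combination -h

/-- The coordinates of `F' v`. -/
lemma Fline_mulVec (v : Fin 3 → ℂ) : Fline.mulVec v =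
    ![((Real.sqrt 6 / 6 : ℝ) : ℂ) * v 0 + ((1 - Real.sqrt 6 / 3 : ℝ) : ℂ) * v 1
        + ((2 - 5 * Real.sqrt 6 / 6 : ℝ) : ℂ) * v 2,
      ((1 - Real.sqrt 6 / 3 : ℝ) : ℂ) * (v 0 + v 1 + v 2),
      ((2 - 5 * Real.sqrt 6 / 6 : ℝ) : ℂ) * v 0 + ((1 - Real.sqrt 6 / 3 : ℝ) : ℂ) * v 1
        + ((Real.sqrt 6 / 6 : ℝ) : ℂ) * v 2] := by
  have h := sqrt6_sqC
  ext i
  fin_cases i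
  · simp [Fline, Matrix.mulVec, dotProduct, Fin.sum_univ_three, sqrt6_inv]
    linear_combination (v 1 / 6 + v 2 / 3) * h
  · simp [Fline, Matrix.mulVec, dotProduct, Fin.sum_univ_three, sqrt6_inv]
    linear_combination (v 0 / 6 + v 1 / 6 + v 2 / 6) * h
  · simp [Fline, Matrix.mulVec, dotProduct, Fin.sum_univ_three, sqrt6_inv]
    linear_combination (v 1 / 6 + v 0 / 3) * h

/-- Spectral decomposition of `‖F' v‖²`. -/
lemma Fline_normSq (v : Fin 3 → ℂ) : ∑ i, Complex.normSq (Fline.mulVec v i) =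
    (3 - Real.sqrt 6) ^ 2 * ∑ i, Complex.normSq (v i)
      - (3 - Real.sqrt 6) ^ 2 / 6 * Complex.normSq (v 0 - 2 * v 1 + v 2)
      - (5 - 2 * Real.sqrt 6) / 2 * Complex.normSq (v 2 - v 0) := by
  rw [Fline_mulVec]
  simp only [Fin.sum_univ_three, Complex.normSq_apply]
  simp
  generalize Real.sqrt 6 = s at *
  ring_nf

theorem line_walk_transformation_matrix_properties :
    Fline.mulVec uVec = ((3 - Real.sqrt 6 : ℝ) : ℂ) • uVec ∧
    Fline.mulVec wVec = 0 ∧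
    Fline.mulVec zVec = ((Real.sqrt 6 - 2 : ℝ) : ℂ) • zVec ∧
    ∀ v : Fin 3 → ℂ, Real.sqrt (∑ i, Complex.normSq (v i)) = 1 →
      Real.sqrt (∑ i, Complex.normSq (Fline.mulVec v i)) ≤ 3 - Real.sqrt 6 ∧
      (Real.sqrt (∑ i, Complex.normSq (Fline.mulVec v i)) = 3 - Real.sqrt 6 ↔
        ∃ c : ℂ, v = c • uVec) := by
  have h := sqrt6_sqC
  have hlt := sqrt6_lt
  refine ⟨?_, ?_, ?_, ?_⟩
  · rw [Fline_mulVec]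
    ext i
    fin_cases i <;> simp [uVec] <;> ring
  · rw [Fline_mulVec]
    ext i
    fin_cases i <;> simp [wVec]
    · ring
    · right; ring
    · ring
  · rw [Fline_mulVec]
    ext i
    fin_cases i <;> simp [zVec] <;> ring
  · intro v hv
    have hv1 : ∑ i, Complex.normSq (v i) = 1 := by
      rwa [Real.sqrt_eq_one] at hv
    have hF := Fline_normSq v
    rw [hv1, mul_one] at hF
    have ha : 0 < 3 - Real.sqrt 6 := by linarith
    have ha2 : 0 < (3 - Real.sqrt 6) ^ 2 / 6 := by positivity
    have hb2 : 0 < (5 - 2 * Real.sqrt 6) / 2 := by linarith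
    have hn1 := Complex.normSq_nonneg (v 0 - 2 * v 1 + v 2)
    have hn2 := Complex.normSq_nonneg (v 2 - v 0)
    have hm1 := mul_nonneg ha2.le hn1
    have hm2 := mul_nonneg hb2.le hn2
    refine ⟨?_, ?_, ?_⟩
    · rw [Real.sqrt_le_left ha.le]
      linarith
    · intro he
      rw [Real.sqrt_eq_iff_eq_sq (Finset.sum_nonneg fun i _ => Complex.normSq_nonneg _) ha.le] at he
      have e1 : (3 - Real.sqrt 6) ^ 2 / 6 * Complex.normSq (v 0 - 2 * v 1 + v 2) = 0 := by linarith
      have e2 : (5 - 2 * Real.sqrt 6) / 2 * Complex.normSq (v 2 - v 0) = 0 := by linarith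
      have f1 := Complex.normSq_eq_zero.mp ((mul_eq_zero.mp e1).resolve_left ha2.ne')
      have f2 := Complex.normSq_eq_zero.mp ((mul_eq_zero.mp e2).resolve_left hb2.ne')
      have h3 : (Real.sqrt 3 : ℂ) ≠ 0 := by
        simp
      refine ⟨(Real.sqrt 3 : ℂ) * v 0, ?_⟩
      ext i
      fin_cases i
      · simp [uVec]
        field_simp
      · simp [uVec]
        field_simp
        linear_combination -f1 / 2 + f2 / 2
      · simp [uVec]
        field_simp
        linear_combination f2
    · rintro ⟨c, rfl⟩
      rw [Real.sqrt_eq_iff_eq_sq (Finset.sum_nonneg fun i _ => Complex.normSq_nonneg _) ha.le, hF]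
      have g1 : (c • uVec) 0 - 2 * (c • uVec) 1 + (c • uVec) 2 = 0 := by
        simp [uVec]
        ring
      have g2 : (c • uVec) 2 - (c • uVec) 0 = 0 := by
        simp [uVec]
      rw [g1, g2]
      simp
end

section
/- Let F′ = (1/√6)·[[1, √6−2, 2√6−5], [√6−2, √6−2, √6−2], [2√6−5, √6−2, 1]], regarded as a complex matrix, and let μ be a Haar probability measure on the compact group U(3) of unitary 3 × 3 complex matrices. Then for every unit vector e ∈ ℂ³, ∫_{U(3)} ‖F′·(U·e)‖² dμ(U) = (25 − 10√6)/3 (≈ 0.1684). -/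
open Matrix MeasureTheory

namespace GroverAvg

/-- Real quadratic form. -/
noncomputable def Q (w : Fin 3 → ℂ) : ℝ := ∑ i, Complex.normSq ((Fline.mulVec w) i)

lemma Q_eq (w : Fin 3 → ℂ) : Q w = (1 / 6) *
    (Complex.normSq (w 0 + ((Real.sqrt 6 - 2 : ℝ) : ℂ) * w 1 + ((2 * Real.sqrt 6 - 5 : ℝ) : ℂ) * w 2)
    + Complex.normSq (((Real.sqrt 6 - 2 : ℝ) : ℂ) * w 0 + ((Real.sqrt 6 - 2 : ℝ) : ℂ) * w 1
      + ((Real.sqrt 6 - 2 : ℝ) : ℂ) * w 2)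
    + Complex.normSq (((2 * Real.sqrt 6 - 5 : ℝ) : ℂ) * w 0 + ((Real.sqrt 6 - 2 : ℝ) : ℂ) * w 1 + w 2)) := by
  have h6 : Complex.normSq ((Real.sqrt 6 : ℂ))⁻¹ = 1 / 6 := by
    rw [Complex.normSq_inv, Complex.normSq_ofReal, Real.mul_self_sqrt (by norm_num)]; norm_num
  unfold Q Fline
  simp only [Matrix.smul_mulVec, Pi.smul_apply, smul_eq_mul, Complex.normSq_mul, h6]
  rw [← Finset.mul_sum]
  congr 1
  simp [Fin.sum_univ_three, Matrix.mulVec, dotProduct]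

/-- Sign. -/
def sg (a : Bool) : ℝ := if a then 1 else -1

/-- Signed cyclic permutation matrices. -/
noncomputable def M : Fin 3 × Bool × Bool → Matrix (Fin 3) (Fin 3) ℂ
  | (0, a, b) => !![1, 0, 0; 0, (sg a : ℂ), 0; 0, 0, (sg b : ℂ)]
  | (1, a, b) => !![0, 1, 0; 0, 0, (sg a : ℂ); (sg b : ℂ), 0, 0]
  | (2, a, b) => !![0, 0, 1; (sg a : ℂ), 0, 0; 0, (sg b : ℂ), 0]

lemma M_mem (x : Fin 3 × Bool × Bool) : M x ∈ Matrix.unitaryGroup (Fin 3) ℂ := by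
  rw [Matrix.mem_unitaryGroup_iff]
  obtain ⟨k, a, b⟩ := x
  ext i j
  fin_cases k <;> cases a <;> cases b <;> fin_cases i <;> fin_cases j <;>
    simp [M, sg, Matrix.mul_apply, Fin.sum_univ_three, Matrix.star_apply]

lemma sum_Q (w : Fin 3 → ℂ) (hw : ∑ i, Complex.normSq (w i) = 1) :
    ∑ x, Q ((M x).mulVec w) = 4 * (25 - 10 * Real.sqrt 6) := by
  have hs : Real.sqrt 6 ^ 2 = 6 := Real.sq_sqrt (by norm_num)
  have key : ∑ x, Q ((M x).mulVec w) = (1 / 6) * (4 * (2 + 5 * (Real.sqrt 6 - 2) ^ 2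
      + 2 * (2 * Real.sqrt 6 - 5) ^ 2)) * ∑ i, Complex.normSq (w i) := by
    simp only [Q_eq]
    generalize Real.sqrt 6 - 2 = p
    generalize 2 * Real.sqrt 6 - 5 = q
    simp only [Fintype.sum_prod_type, Fin.sum_univ_three, Fintype.sum_bool]
    simp [M, sg, Matrix.mulVec, dotProduct, Fin.sum_univ_three, Complex.normSq_apply]
    ring
  rw [key, hw]
  linear_combination (13 / 6 * 4) * hs

lemma norm_U (U : Matrix.unitaryGroup (Fin 3) ℂ) (e : Fin 3 → ℂ) :
    ∑ i, Complex.normSq ((U : Matrix (Fin 3) (Fin 3) ℂ).mulVec e i)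
      = ∑ i, Complex.normSq (e i) := by
  have h (v : Fin 3 → ℂ) : ((∑ i, Complex.normSq (v i) : ℝ) : ℂ) = star v ⬝ᵥ v := by
    simp [dotProduct, Complex.normSq_eq_conj_mul_self]
  have hU : (U : Matrix (Fin 3) (Fin 3) ℂ)ᴴ * U = 1 := Matrix.mem_unitaryGroup_iff'.1 U.2
  have : ((∑ i, Complex.normSq ((U : Matrix (Fin 3) (Fin 3) ℂ).mulVec e i) : ℝ) : ℂ)
      = ((∑ i, Complex.normSq (e i) : ℝ) : ℂ) := by
    rw [h, h, Matrix.star_mulVec, Matrix.dotProduct_mulVec, Matrix.vecMul_vecMul, hU,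
      Matrix.vecMul_one]
  exact_mod_cast this

lemma cont_Q (V : Matrix (Fin 3) (Fin 3) ℂ) (e : Fin 3 → ℂ) :
    Continuous fun U : Matrix.unitaryGroup (Fin 3) ℂ =>
      Q (V.mulVec ((U : Matrix (Fin 3) (Fin 3) ℂ).mulVec e)) := by
  have h : Continuous fun U : Matrix.unitaryGroup (Fin 3) ℂ =>
      Fline.mulVec (V.mulVec ((U : Matrix (Fin 3) (Fin 3) ℂ).mulVec e)) :=
    Continuous.matrix_mulVec continuous_const (Continuous.matrix_mulVec continuous_const
      (Continuous.matrix_mulVec continuous_subtype_val continuous_const))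
  unfold Q
  exact continuous_finsetSum _ fun i _ =>
    Complex.continuous_normSq.comp ((continuous_pi_iff.1 h) i)

lemma Q_nonneg (w : Fin 3 → ℂ) : 0 ≤ Q w :=
  Finset.sum_nonneg fun _ _ => Complex.normSq_nonneg _

end GroverAvg

open GroverAvg in
theorem average_localization_probability_line_walk
    [MeasurableSpace (Matrix.unitaryGroup (Fin 3) ℂ)]
    [BorelSpace (Matrix.unitaryGroup (Fin 3) ℂ)]
    (μ : Measure (Matrix.unitaryGroup (Fin 3) ℂ))
    [μ.IsHaarMeasure] [IsProbabilityMeasure μ]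
    (e : Fin 3 → ℂ) (he : ∑ i, Complex.normSq (e i) = 1) :
    ∫ U : Matrix.unitaryGroup (Fin 3) ℂ,
        (∑ i, Complex.normSq ((Fline.mulVec ((U : Matrix (Fin 3) (Fin 3) ℂ).mulVec e)) i)) ∂μ
      = (25 - 10 * Real.sqrt 6) / 3 := by
  change ∫ U : Matrix.unitaryGroup (Fin 3) ℂ, Q ((U : Matrix (Fin 3) (Fin 3) ℂ).mulVec e) ∂μ = _
  have hpt (U : Matrix.unitaryGroup (Fin 3) ℂ) :=
    sum_Q ((U : Matrix (Fin 3) (Fin 3) ℂ).mulVec e) ((norm_U U e).trans he)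
  have hinv (x) : ∫ U : Matrix.unitaryGroup (Fin 3) ℂ,
      Q ((M x).mulVec ((U : Matrix (Fin 3) (Fin 3) ℂ).mulVec e)) ∂μ
      = ∫ U : Matrix.unitaryGroup (Fin 3) ℂ, Q ((U : Matrix (Fin 3) (Fin 3) ℂ).mulVec e) ∂μ := by
    rw [← integral_mul_left_eq_self (fun U : Matrix.unitaryGroup (Fin 3) ℂ =>
      Q ((U : Matrix (Fin 3) (Fin 3) ℂ).mulVec e)) (⟨M x, M_mem x⟩ : Matrix.unitaryGroup (Fin 3) ℂ)]
    simp [Matrix.mulVec_mulVec]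
  have hint (x) : Integrable (fun U : Matrix.unitaryGroup (Fin 3) ℂ =>
      Q ((M x).mulVec ((U : Matrix (Fin 3) (Fin 3) ℂ).mulVec e))) μ := by
    refine Integrable.of_bound (cont_Q _ _).measurable.aestronglyMeasurable
      (4 * (25 - 10 * Real.sqrt 6)) (Filter.Eventually.of_forall fun U => ?_)
    rw [Real.norm_of_nonneg (Q_nonneg _), ← hpt U]
    exact Finset.single_le_sum (f := fun x =>
      Q ((M x).mulVec ((U : Matrix (Fin 3) (Fin 3) ℂ).mulVec e)))
      (fun _ _ => Q_nonneg _) (Finset.mem_univ x)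
  have h := integral_finsetSum Finset.univ (fun x _ => hint x)
  simp only [hpt, hinv] at h
  simp at h
  linarith
end
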